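/- Let U be a 2-dimensional pure simplicial complex on at most 7 vertices with at most 10 triangles, in which every edge lies in an even number of triangles. Then either U is the union of two combinatorial 2-spheres (each on 4 or 5 vertices) having no common triangle, or U is isomorphic to one of: S²₄, S¹₃ * S⁰₂, S⁰₂ * S⁰₂ * S⁰₂, S¹₅ * S⁰₂, RP²₆, one of the five triangulated 2-spheres Σ₁, …, Σ₅, or the complex R obtained from RP²₆ by a generalized bistellar 1-move κ_A for a 4-subset A of its vertex set (all such choices of A yield isomorphic complexes). -/

import Mathlib

/- Formalization of definitions from:
   B. Bagchi, B. Datta, "Combinatorial triangulations of homology spheres". -/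

open Finset

noncomputable section

attribute [local instance] Classical.propDecidable

namespace HomologySpheres

variable {V : Type*} [DecidableEq V] {W : Type*} [DecidableEq W]

/-- The vertex set of a finite family of finite sets. -/
def verts (K : Finset (Finset V)) : Finset V := K.sup id

/-- An (abstract, finite) simplicial complex: a nonempty collection of nonempty
finite sets closed under taking nonempty subsets. -/
def IsComplex (K : Finset (Finset V)) : Prop :=
  K.Nonempty ∧ ∅ ∉ K ∧ ∀ s ∈ K, ∀ t : Finset V, t ⊆ s → t.Nonempty → t ∈ K

/-- The facets (maximal faces) of `K`. -/
def facets (K : Finset (Finset V)) : Finset (Finset V) :=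
  K.filter fun s => ∀ t ∈ K, s ⊆ t → t = s

/-- `K` is pure of dimension `d`: every maximal face has `d + 1` vertices. -/
def IsPure (d : ℕ) (K : Finset (Finset V)) : Prop :=
  ∀ s ∈ facets K, s.card = d + 1

/-- The link of a face `σ` in `K`. -/
def link (K : Finset (Finset V)) (σ : Finset V) : Finset (Finset V) :=
  K.filter fun τ => Disjoint τ σ ∧ τ ∪ σ ∈ K

/-- `L` is an induced (full) subcomplex of `K`. -/
def IsInduced (K L : Finset (Finset V)) : Prop :=
  L ⊆ K ∧ ∀ s ∈ K, s ⊆ verts L → s ∈ L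

/-- The simplicial complement `C(L, K)`: the induced subcomplex of `K` on
`V(K) \ V(L)`. -/
def simpComplement (L K : Finset (Finset V)) : Finset (Finset V) :=
  K.filter fun s => s ⊆ verts K \ verts L

/-- The simplicial neighbourhood `N(L, K)`: the subcomplex of `K` whose maximal
faces are the maximal faces of `K` meeting `V(L)`. -/
def simpNbhd (L K : Finset (Finset V)) : Finset (Finset V) :=
  K.filter fun s => ∃ t ∈ facets K, s ⊆ t ∧ (t ∩ verts L).Nonempty

/-- `fvec K i` is the number of `i`-dimensional faces of `K`. -/
def fvec (K : Finset (Finset V)) (i : ℕ) : ℕ :=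
  (K.filter fun s => s.card = i + 1).card

/-- The number of facets of cardinality `d + 1` containing a given `(d-1)`-face
(the degree of the face in a (weak) pseudomanifold of dimension `d`). -/
def degOf (K : Finset (Finset V)) (d : ℕ) (s : Finset V) : ℕ :=
  (K.filter fun t => s ⊆ t ∧ t.card = d + 1).card

/-- Simplicial isomorphism (via a vertex bijection carrying faces to faces). -/
def Iso (K : Finset (Finset V)) (L : Finset (Finset W)) : Prop :=
  ∃ f : V → W, Set.InjOn f ↑(verts K) ∧ L = K.image (Finset.image f)

/-- The join of two simplicial complexes (on disjoint vertex sets). -/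
def sjoin (K L : Finset (Finset V)) : Finset (Finset V) :=
  K ∪ L ∪ (K ×ˢ L).image fun p => p.1 ∪ p.2

/-- The standard ball on vertex set `A`: all nonempty subsets of `A`. -/
def stdBall (A : Finset V) : Finset (Finset V) := A.powerset.erase ∅

/-- The standard sphere on vertex set `A`: all nonempty proper subsets of `A`. -/
def stdSphere (A : Finset V) : Finset (Finset V) := (A.powerset.erase ∅).erase A

/-- `τ` is a free face of `K`, with `σ` the unique face properly containing it. -/
def IsFreeFace (K : Finset (Finset V)) (τ σ : Finset V) : Prop :=
  τ ∈ K ∧ σ ∈ K ∧ τ ⊂ σ ∧ ∀ ρ ∈ K, τ ⊂ ρ → ρ = σ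

/-- An elementary collapse removes a free face together with the unique face
properly containing it. -/
def ElemCollapse (K K' : Finset (Finset V)) : Prop :=
  ∃ τ σ : Finset V, IsFreeFace K τ σ ∧ K' = (K.erase τ).erase σ

/-- `K` collapses to `L` by a sequence of elementary collapses. -/
def CollapsesTo (K L : Finset (Finset V)) : Prop :=
  Relation.ReflTransGen ElemCollapse K L

/-- `K` is collapsible: it collapses to a single vertex. -/
def Collapsible (K : Finset (Finset V)) : Prop :=
  ∃ v : V, CollapsesTo K {{v}}

/-! ### Simplicial homology with `ℤ/2` coefficients (augmented chain complex).
A chain of level `n` is a `ZMod 2`-valued function supported on the faces of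
cardinality `n` (the empty set, of cardinality `0`, serves as the `(-1)`-simplex
of the augmented complex).  Reduced homology in dimension `q` lives at level
`q + 1`. -/

/-- `c` is a chain of level `n` of `K` (over `ℤ/2`). -/
def z2chainOK (K : Finset (Finset V)) (n : ℕ) (c : Finset V → ZMod 2) : Prop :=
  ∀ s : Finset V, c s ≠ 0 → s.card = n ∧ (s ∈ K ∨ s = ∅)

/-- The mod-2 boundary operator. -/
def z2bdry (K : Finset (Finset V)) (c : Finset V → ZMod 2) : Finset V → ZMod 2 :=
  fun t => ∑ v ∈ verts K \ t, c (insert v t)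

/-- `K` is `ℤ/2`-acyclic: all reduced homology with `ℤ/2` coefficients vanishes,
i.e. in the augmented mod-2 chain complex every cycle is a boundary. -/
def Z2Acyclic (K : Finset (Finset V)) : Prop :=
  ∀ (n : ℕ) (c : Finset V → ZMod 2), z2chainOK K n c → z2bdry K c = 0 →
    ∃ c', z2chainOK K (n + 1) c' ∧ z2bdry K c' = c

/-- `K` has the reduced `ℤ/2`-homology of the `d`-sphere: reduced homology
vanishes in all dimensions except `d` (level `d + 1`), where it is `ℤ/2`
(there is a cycle `z` which is not a boundary, and modulo boundaries every
cycle is `0` or `z`). -/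
def Z2HomologySphere (d : ℕ) (K : Finset (Finset V)) : Prop :=
  (∀ (n : ℕ) (c : Finset V → ZMod 2), n ≠ d + 1 → z2chainOK K n c →
    z2bdry K c = 0 → ∃ c', z2chainOK K (n + 1) c' ∧ z2bdry K c' = c) ∧
  (∃ z : Finset V → ZMod 2, z2chainOK K (d + 1) z ∧ z2bdry K z = 0 ∧
    (∀ c', z2chainOK K (d + 2) c' → z2bdry K c' ≠ z) ∧
    (∀ z', z2chainOK K (d + 1) z' → z2bdry K z' = 0 →
      (∃ c', z2chainOK K (d + 2) c' ∧ z2bdry K c' = z') ∨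
      (∃ c', z2chainOK K (d + 2) c' ∧ z2bdry K c' = z + z')))

/-! ### Integral simplicial homology via ordered chains (Munkres §13: ordered
simplicial homology, allowing repeated vertices, agrees with simplicial
homology). An ordered `m`-tuple chain corresponds to dimension `m - 1`; the
unique `0`-tuple is the `(-1)`-simplex of the augmented complex. -/

/-- `c` is an ordered chain of `K` over `ℤ`: supported on tuples whose image is
a face (the empty tuple being allowed in level `0`). -/
def zchainOK (K : Finset (Finset V)) {m : ℕ} (c : (Fin m → V) → ℤ) : Prop :=
  ∀ x : Fin m → V, c x ≠ 0 → (Finset.univ.image x ∈ K ∨ m = 0)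

/-- The integral boundary operator on ordered chains. -/
def zbdry (K : Finset (Finset V)) {m : ℕ} (c : (Fin (m + 1) → V) → ℤ) :
    (Fin m → V) → ℤ :=
  fun y => ∑ i : Fin (m + 1), (-1 : ℤ) ^ (i : ℕ) * ∑ v ∈ verts K, c (i.insertNth v y)

/-- `K` has the reduced integral homology of the `d`-sphere: reduced homology
vanishes in all dimensions except `d`, where it is infinite cyclic (there is a
cycle `z` such that every cycle is, modulo boundaries, a unique multiple of `z`). -/
def ZHomologySphere (d : ℕ) (K : Finset (Finset V)) : Prop :=
  (∀ c : (Fin 0 → V) → ℤ, ∃ c' : (Fin 1 → V) → ℤ, zchainOK K c' ∧ zbdry K c' = c) ∧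
  (∀ (m : ℕ) (c : (Fin (m + 1) → V) → ℤ), m ≠ d → zchainOK K c → zbdry K c = 0 →
    ∃ c' : (Fin (m + 2) → V) → ℤ, zchainOK K c' ∧ zbdry K c' = c) ∧
  (∃ z : (Fin (d + 1) → V) → ℤ, zchainOK K z ∧ zbdry K z = 0 ∧
    ∀ z' : (Fin (d + 1) → V) → ℤ, zchainOK K z' → zbdry K z' = 0 →
      ∃! k : ℤ, ∃ c'' : (Fin (d + 2) → V) → ℤ,
        zchainOK K c'' ∧ zbdry K c'' = z' - k • z)

/-- A weak pseudomanifold of dimension `d`: pure, and every `(d-1)`-face is in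
exactly two facets. -/
def IsWeakPseudomanifold (d : ℕ) (K : Finset (Finset V)) : Prop :=
  IsComplex K ∧ IsPure d K ∧ ∀ s ∈ K, s.card = d → degOf K d s = 2

/-- Adjacency of facets along a common `(d-1)`-face. -/
def FacetAdj (d : ℕ) (K : Finset (Finset V)) (s t : Finset V) : Prop :=
  s ∈ K ∧ t ∈ K ∧ s.card = d + 1 ∧ t.card = d + 1 ∧ (s ∩ t).card = d

/-- A pseudomanifold: a weak pseudomanifold in which any two facets are joined
by a chain of facets, consecutive ones sharing a `(d-1)`-face. -/
def IsPseudomanifold (d : ℕ) (K : Finset (Finset V)) : Prop :=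
  IsWeakPseudomanifold d K ∧ ∀ s ∈ K, ∀ t ∈ K, s.card = d + 1 → t.card = d + 1 →
    Relation.ReflTransGen (FacetAdj d K) s t

/-- A weak pseudomanifold with boundary. -/
def IsWeakPseudomanifoldWithBdry (d : ℕ) (K : Finset (Finset V)) : Prop :=
  IsComplex K ∧ IsPure d K ∧
  (∀ s ∈ K, s.card = d → degOf K d s = 1 ∨ degOf K d s = 2) ∧
  (∃ s ∈ K, s.card = d ∧ degOf K d s = 1)

/-- The boundary complex: all faces of degree-one `(d-1)`-faces. -/
def bdryComplex (d : ℕ) (K : Finset (Finset V)) : Finset (Finset V) :=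
  K.filter fun t => ∃ s ∈ K, t ⊆ s ∧ s.card = d ∧ degOf K d s = 1

/-- `K` is connected (any two vertices joined by a path of edges). -/
def SConnected (K : Finset (Finset V)) : Prop :=
  ∀ u ∈ verts K, ∀ v ∈ verts K,
    Relation.ReflTransGen (fun a b : V => ({a, b} : Finset V) ∈ K) u v

/-! ### Geometric realizations, subdivisions and combinatorial equivalence. -/

/-- A geometric simplicial complex in `ℝ^ℕ`: finitely many geometric simplices
(affinely independent vertex sets), closed under faces, any two of which meet
in a common face. -/
structure GComplex where
  faces : Finset (Finset (ℕ → ℝ))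
  nonempty : faces.Nonempty
  empty_not_mem : ∅ ∉ faces
  down_closed : ∀ s ∈ faces, ∀ t : Finset (ℕ → ℝ), t ⊆ s → t.Nonempty → t ∈ faces
  indep : ∀ s ∈ faces,
    AffineIndependent ℝ (fun x : {y : ℕ → ℝ // y ∈ s} => (x : ℕ → ℝ))
  glue : ∀ s ∈ faces, ∀ t ∈ faces,
    convexHull ℝ (s : Set (ℕ → ℝ)) ∩ convexHull ℝ (t : Set (ℕ → ℝ)) =
      convexHull ℝ ((s ∩ t : Finset (ℕ → ℝ)) : Set (ℕ → ℝ))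

/-- The geometric carrier (underlying polyhedron) of a geometric complex. -/
def GComplex.carrier (G : GComplex) : Set (ℕ → ℝ) :=
  ⋃ s ∈ G.faces, convexHull ℝ (s : Set (ℕ → ℝ))

/-- `G` realizes the abstract complex `K` via the vertex map `f`. -/
def RealizesMap (G : GComplex) (K : Finset (Finset V)) (f : V → ℕ → ℝ) : Prop :=
  Set.InjOn f ↑(verts K) ∧ G.faces = K.image (Finset.image f)

/-- `G` is a geometric realization of the abstract complex `K`. -/
def Realizes (G : GComplex) (K : Finset (Finset V)) : Prop :=
  ∃ f : V → ℕ → ℝ, RealizesMap G K f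

/-- `G'` is a subdivision of `G`: same carrier, and every simplex of `G'` is
contained in a simplex of `G`. -/
def Subdivides (G' G : GComplex) : Prop :=
  G'.carrier = G.carrier ∧
  ∀ s ∈ G'.faces, ∃ t ∈ G.faces,
    convexHull ℝ (s : Set (ℕ → ℝ)) ⊆ convexHull ℝ (t : Set (ℕ → ℝ))

/-- Combinatorial equivalence: `K` and `L` admit isomorphic subdivisions. -/
def CombEquiv (K : Finset (Finset V)) (L : Finset (Finset W)) : Prop :=
  ∃ G1 G1' G2 G2' : GComplex, Realizes G1 K ∧ Realizes G2 L ∧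
    Subdivides G1' G1 ∧ Subdivides G2' G2 ∧ Iso G1'.faces G2'.faces

/-- A combinatorial `d`-ball: combinatorially equivalent to the standard ball. -/
def IsCombBall (d : ℕ) (K : Finset (Finset V)) : Prop :=
  ∃ A : Finset ℕ, A.card = d + 1 ∧ CombEquiv K (stdBall A)

/-- A combinatorial `d`-sphere: combinatorially equivalent to the standard sphere. -/
def IsCombSphere (d : ℕ) (K : Finset (Finset V)) : Prop :=
  ∃ A : Finset ℕ, A.card = d + 2 ∧ CombEquiv K (stdSphere A)

/-- A combinatorial `d`-manifold: every vertex link is a combinatorial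
`(d-1)`-sphere. -/
def IsCombManifold (d : ℕ) (K : Finset (Finset V)) : Prop :=
  IsComplex K ∧ ∀ v ∈ verts K, IsCombSphere (d - 1) (link K {v})

/-- A combinatorial `d`-manifold with boundary. -/
def IsCombManifoldWithBdry (d : ℕ) (K : Finset (Finset V)) : Prop :=
  IsComplex K ∧
  (∀ v ∈ verts K, IsCombSphere (d - 1) (link K {v}) ∨
    IsCombBall (d - 1) (link K {v})) ∧
  (∃ v ∈ verts K, IsCombBall (d - 1) (link K {v}))

/-- A pl `k`-ball: a polyhedron carried by some geometric complex whose face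
structure is a combinatorial `k`-ball. -/
def IsPLBall (k : ℕ) (P : Set (ℕ → ℝ)) : Prop :=
  ∃ G : GComplex, G.carrier = P ∧ IsCombBall k G.faces

/-- Elementary polyhedral collapse: `P = P' ∪ B` with `B` a pl `k`-ball and
`P' ∩ B` a pl `(k-1)`-ball. -/
def PolyElemCollapse (P P' : Set (ℕ → ℝ)) : Prop :=
  ∃ k : ℕ, 1 ≤ k ∧ ∃ B : Set (ℕ → ℝ),
    IsPLBall k B ∧ P = P' ∪ B ∧ IsPLBall (k - 1) (P' ∩ B)

/-- Polyhedral collapse. -/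
def PolyCollapsesTo (P Q : Set (ℕ → ℝ)) : Prop :=
  Relation.ReflTransGen PolyElemCollapse P Q

/-- Carrier of a subcomplex under a vertex realization map `f`. -/
def subCarrier (f : V → ℕ → ℝ) (L : Finset (Finset V)) : Set (ℕ → ℝ) :=
  ⋃ s ∈ L, convexHull ℝ ((s.image f : Finset (ℕ → ℝ)) : Set (ℕ → ℝ))

/-! ### Bistellar moves. -/

/-- The core `β = {x ∈ A : A \ {x} ∈ X}` of a `(d+2)`-set `A`. -/
def bcore (X : Finset (Finset V)) (A : Finset V) : Finset V :=
  A.filter fun x => A.erase x ∈ X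

/-- `κ_A` is a bistellar `i`-move on the `d`-dimensional complex `X`:
`A` has `d + 2` elements and contains at least one and at most `d + 1` facets
of `X`; with `β` the core of `A` and `α = A \ β` an `i`-face of `X`, one has
`β ∉ X`, and either `α` is a facet of `X` or `Lk_X(α)` has vertex set `β`. -/
def BistellarIMove (d i : ℕ) (X : Finset (Finset V)) (A : Finset V) : Prop :=
  A.card = d + 2 ∧
  0 < ((facets X).filter fun σ => σ ⊆ A).card ∧
  ((facets X).filter fun σ => σ ⊆ A).card ≤ d + 1 ∧
  bcore X A ∉ X ∧
  A \ bcore X A ∈ X ∧ (A \ bcore X A).card = i + 1 ∧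
  (A \ bcore X A ∈ facets X ∨ verts (link X (A \ bcore X A)) = bcore X A)

/-! ### The explicit small complexes of the paper. -/

/-- The complex generated by a list of facets: all nonempty subsets thereof. -/
def genBy (F : Finset (Finset ℕ)) : Finset (Finset ℕ) :=
  F.sup fun s => s.powerset.erase ∅

/-- The standard 2-sphere `S²₄`. -/
def S24 : Finset (Finset ℕ) := stdSphere {1, 2, 3, 4}

/-- The join `S¹₃ * S⁰₂`. -/
def S13S02 : Finset (Finset ℕ) := sjoin (stdSphere {1, 2, 3}) (stdSphere {4, 5})

/-- The octahedron `S⁰₂ * S⁰₂ * S⁰₂`. -/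
def Octa : Finset (Finset ℕ) :=
  sjoin (stdSphere {1, 2}) (sjoin (stdSphere {3, 4}) (stdSphere {5, 6}))

/-- The 6-vertex real projective plane `ℝP²₆`. -/
def RP26 : Finset (Finset ℕ) :=
  genBy {{1, 2, 3}, {1, 2, 4}, {1, 3, 5}, {1, 4, 6}, {1, 5, 6},
         {2, 3, 6}, {2, 4, 5}, {2, 5, 6}, {3, 4, 5}, {3, 4, 6}}

/-- `Σ₁`: the 6-vertex 2-sphere with a vertex of degree 3 and one of degree 5. -/
def Sigma1 : Finset (Finset ℕ) :=
  genBy {{1, 2, 5}, {1, 2, 6}, {1, 5, 6}, {2, 3, 5},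
         {2, 3, 6}, {3, 4, 5}, {3, 4, 6}, {4, 5, 6}}

/-- The double pyramid `S¹₅ * S⁰₂`. -/
def S15S02 : Finset (Finset ℕ) :=
  sjoin (genBy {{1, 2}, {2, 3}, {3, 4}, {4, 5}, {1, 5}}) (stdSphere {6, 7})

/-- `Σ₂` (7-vertex 2-sphere with 10 triangles). -/
def Sigma2 : Finset (Finset ℕ) :=
  genBy {{1, 2, 6}, {1, 2, 7}, {1, 6, 7}, {2, 3, 6}, {2, 3, 7},
         {3, 4, 6}, {3, 4, 7}, {4, 5, 6}, {4, 5, 7}, {5, 6, 7}}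

/-- `Σ₃` (7-vertex 2-sphere with 10 triangles). -/
def Sigma3 : Finset (Finset ℕ) :=
  genBy {{1, 2, 6}, {1, 2, 7}, {1, 6, 7}, {2, 3, 4}, {2, 3, 7},
         {2, 4, 6}, {3, 4, 7}, {4, 5, 6}, {4, 5, 7}, {5, 6, 7}}

/-- `Σ₄` (7-vertex 2-sphere with 10 triangles). -/
def Sigma4 : Finset (Finset ℕ) :=
  genBy {{1, 2, 4}, {1, 2, 7}, {1, 4, 5}, {1, 5, 6}, {1, 6, 7},
         {2, 3, 4}, {2, 3, 7}, {3, 4, 7}, {4, 5, 7}, {5, 6, 7}}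

/-- `Σ₅` (7-vertex 2-sphere with 10 triangles). -/
def Sigma5 : Finset (Finset ℕ) :=
  genBy {{1, 2, 3}, {1, 2, 6}, {1, 3, 5}, {1, 5, 6}, {2, 3, 4},
         {2, 4, 6}, {3, 4, 5}, {4, 5, 7}, {4, 6, 7}, {5, 6, 7}}

/-- `Υ₁ = S²₄ ∪ S²₄`: two tetrahedral spheres sharing exactly one vertex. -/
def Upsilon1 : Finset (Finset ℕ) :=
  stdSphere {1, 2, 3, 7} ∪ stdSphere {4, 5, 6, 7}

/-- `Υ₂ = S²₄ ∪ (S⁰₂ * S¹₃)`: a tetrahedral sphere and a join, where the two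
common vertices span an edge of the `S²₄`. -/
def Upsilon2 : Finset (Finset ℕ) :=
  stdSphere {4, 5, 6, 7} ∪ sjoin (stdSphere {6, 7}) (stdSphere {1, 2, 3})

/-- The complex `R` obtained from `ℝP²₆` by the generalized bistellar 1-move
`κ_A`, `A = {1, 2, 5, 6}` (all such choices of `A` yield isomorphic complexes). -/
def Rcomplex : Finset (Finset ℕ) :=
  genBy {{1, 2, 3}, {1, 2, 4}, {1, 2, 5}, {1, 2, 6}, {1, 3, 5},
         {1, 4, 6}, {2, 3, 6}, {2, 4, 5}, {3, 4, 5}, {3, 4, 6}}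


/-! ### Kernel computation -/

/-- Walk through a list of flagged triples, collecting those flagged `true`; give up (returning
`true`) as soon as there are more than `fuel` of them. -/
def go (leaf : List (ℕ × ℕ × ℕ) → Bool) : List (Bool × ℕ × ℕ × ℕ) → ℕ → List (ℕ × ℕ × ℕ) → Bool
  | [], _, acc => leaf acc
  | (b, t) :: xs, fuel, acc =>
    match b with
    | false => go leaf xs fuel acc
    | true =>
      match fuel with
      | 0 => true
      | k + 1 => go leaf xs k (t :: acc)

/-- Models: bit masks of the ordered triples `64 a + 8 b + c`, with the number of triangles. -/
def modelTab : List (ℕ × ℕ) :=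
  [(0x60a0c0000000006001214000000000a120018000000000c141800000000000000000000, 4),
   (0x60a0c0000000000060a0c00000006060030300000000a0a3000300000000c0c303000000000000000000000, 6),
   (0x606181800000000060618180000060600006060000006060000606000001818606000000000181860600000000000000000000000, 8),
   (0x1228140a240000001228140a2400121200c00000c0002828c000c0000000141400c000c000000a0a0000c000c0002424c00000c000000000000000000000, 10),
   (0x60a142830000006000c12504800000a0c00602244000014126000422400002850224200180000304844241800000000000000000000, 10),
   (0x1228140a240000120048140a440000284800600000000014146000600000000a0a006000600000244400006000000000000000000000, 8),
   (0x225028140a440022009028140a8400509000c0000000002828c000c0000000141400c000c000000a0a0000c000c0004484000000c000000000000000000000, 10),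
   (0x225028140a44002200902400128400509000c0000000002824c0008448000014000084009000000a1200489000c0004484000000c000000000000000000000, 10),
   (0x225028140a4400220082000000a000508200820000500028008200840a240014000084009000000a00000a9000900044a05024009000000000000000000000, 10),
   (0x305060000000003000828400122400508200881200480060848800244800000000122400122400001200481200480000244800244800000000000000000000, 10),
   (0xa140a14000000000c12120c00000a0c00602244000014126000422400000a12224200780000140c44247800000000000000000000, 10),
   (0x60000222400000600000042440000000000060a0c0000000006001214000022420a120078000024440c147800000000000000000000, 8),
   (0x22420000006000220082000000a000428200000000c00000000000060a0c0000000006001214000000000a1200180060a0c00c141800000000000000000000, 8),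
   (0x60a0c0000000000060a0c0000000000060a0c000006060600727400000a0a0a72007800000c0c0c747800000000000000000000, 10),
   (0x6000022240000000600002224000606000000c0c00000000000060a0c0000000006001214002222c00a1200d8002424c00c14d800000000000000000000, 10),
   (0xc0022220c00000c000042420c0000000000060a0c0000224206001274000022420a12007800000c0c0c747800000000000000000000, 10),
   (0x224200000060002200840000228400428400000042840000000000060a0c0000000006001214000022420a120078006084840c147800000000000000000000, 10),
   (0x60600006060000600060000a0a0000606000000c0c00000000000060a0c00000000060012140060a0c00a1200180060a0c00c141800000000000000000000, 10)]

/-- The vertex map stored in a certificate. -/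
def cmap (c v : ℕ) : ℕ := (c >>> (3 * v)) % 8

def pairs7 : List (ℕ × ℕ) :=
  [(0, 1), (0, 2), (0, 3), (0, 4), (0, 5), (0, 6), (1, 2),
   (1, 3), (1, 4), (1, 5), (1, 6), (2, 3), (2, 4), (2, 5),
   (2, 6), (3, 4), (3, 5), (3, 6), (4, 5), (4, 6), (5, 6)]

/-- The certificate `c` maps the triples of `acc` into a model. -/
def certOK (c : ℕ) (acc : List (ℕ × ℕ × ℕ)) : Bool :=
  match modelTab[c >>> 21]? with
  | none => false
  | some (m, n) =>
    acc.all (fun t => Nat.testBit m (64 * cmap c t.1 + 8 * cmap c t.2.1 + cmap c t.2.2)) &&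
      (Nat.beq acc.length n &&
        pairs7.all (fun q => !(Nat.beq (cmap c q.1) (cmap c q.2))))

def leafOK (N idx : ℕ) (acc : List (ℕ × ℕ × ℕ)) : Bool :=
  match acc with
  | [] => true
  | t :: ts => certOK ((N >>> (26 * idx)) % 2 ^ 26) (t :: ts)

/-- The thirty-five triples, flagged according to the parity conditions. -/
def flagged (b123 b124 b125 b134 b135 b145 b234 b235 b245 b345 l12 l13 l14 l15 l23 l24 l25 l34 l35 l45 : Bool) : List (Bool × ℕ × ℕ × ℕ) :=
  [(b123, 1, 2, 3),
   (b124, 1, 2, 4),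
   (b125, 1, 2, 5),
   (b134, 1, 3, 4),
   (b135, 1, 3, 5),
   (b145, 1, 4, 5),
   (b234, 2, 3, 4),
   (b235, 2, 3, 5),
   (b245, 2, 4, 5),
   (b345, 3, 4, 5),
   (l12, 1, 2, 6),
   (l13, 1, 3, 6),
   (l14, 1, 4, 6),
   (l15, 1, 5, 6),
   (l23, 2, 3, 6),
   (l24, 2, 4, 6),
   (l25, 2, 5, 6),
   (l34, 3, 4, 6),
   (l35, 3, 5, 6),
   (l45, 4, 5, 6),
   ((b123 ^^ (b124 ^^ (b125 ^^ l12))), 0, 1, 2),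
   ((b123 ^^ (b134 ^^ (b135 ^^ l13))), 0, 1, 3),
   ((b124 ^^ (b134 ^^ (b145 ^^ l14))), 0, 1, 4),
   ((b125 ^^ (b135 ^^ (b145 ^^ l15))), 0, 1, 5),
   ((l12 ^^ (l13 ^^ (l14 ^^ l15))), 0, 1, 6),
   ((b123 ^^ (b234 ^^ (b235 ^^ l23))), 0, 2, 3),
   ((b124 ^^ (b234 ^^ (b245 ^^ l24))), 0, 2, 4),
   ((b125 ^^ (b235 ^^ (b245 ^^ l25))), 0, 2, 5),
   ((l12 ^^ (l23 ^^ (l24 ^^ l25))), 0, 2, 6),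
   ((b134 ^^ (b234 ^^ (b345 ^^ l34))), 0, 3, 4),
   ((b135 ^^ (b235 ^^ (b345 ^^ l35))), 0, 3, 5),
   ((l13 ^^ (l23 ^^ (l34 ^^ l35))), 0, 3, 6),
   ((b145 ^^ (b245 ^^ (b345 ^^ l45))), 0, 4, 5),
   ((l14 ^^ (l24 ^^ (l34 ^^ l45))), 0, 4, 6),
   ((l15 ^^ (l25 ^^ (l35 ^^ l45))), 0, 5, 6)]

def idxOf (b123 b124 b125 b134 b135 b145 b234 b235 b245 b345 : Bool) : ℕ :=
  cond b123 1 0 + cond b124 2 0 + cond b125 4 0 + cond b134 8 0 + cond b135 16 0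
    + cond b145 32 0 + cond b234 64 0 + cond b235 128 0 + cond b245 256 0 + cond b345 512 0

def certN0 : ℕ :=
  0x1bda3ac0000000000000000000000000000000000000000000001fcb5350000000000000000000000000000000000000000000001fd95350000001bdac6c0000001fcb8b50000001fd98b500000017d1d630000000000000000000000000000000000000000000001fda33500000000000006f791b1fcc6b500000000000007f70ad57d6363000000000000000000000000006fcd1b1fe16b57f8cad57f23630000001fda8757f711d57d6a637f8d1d57f2a635fd518c1e34750000000000000000000000000000000000000000000001fcb5a5000000000000000000000000007f2d6b0000000000000000000000000000000007f2f2b00000007f675500000005746c795d19730000001fcbca5000000000000057465795d1b330000001fd9d620000001fce6ac00000000000007f78d515d531e00000015d437300000000000007f39a940000005750d780000005754ccdfde3627f7a9515d585e57529780000000fad198be3d512f99d44be6aca00000015d4a7357561cdfdea622f9ab44be674a2f8f5283eb4740000000000000000000000000000000000000000000001fd95a500000000000007f2f5500000007f672b000000057474755d19ab00000000000007f656b0000000000000000000000000000000000000001fd9ca557466755d1d2b00000000000000000001fcbd620000001ff16ac7fccd515ea31e000000000000000000015e23737fce9515ea85e0f75198bdcd51578a9780000002fd1d44bf4aca0000000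0000005788d780000007fc5a9400000057a8ccdff336200000015e2a732fd2b44bf474a57aa1cdff3a622f735283dd4740000001bdad4c0000001fcb9950000001fd999500000017d1d2b0000001fcbd15000000000000057463b95d1ba30000001fd9d2a0000001fd9d1557463d55d1d6300000000000000000001fcbd2a00000017d19ab0000001fd99aa0000001fcb9aa0000001bdad617fd5a303dab0e57b1338bde8a95795338bf38a90000000bf585a57b1a38bde5292f6b5845d4d59278ee455e3b915795ac4bf350d5795a38bf3529278f5455e3d512f4f5845e2d5957b1ac4bde50d0000000bf585357953c4bf388d57b13c4bde88d7fd5a843dab310000000000000000000000000000000000000000000001fda3a50000001fce75400000000000007f78ab15d631d00000015d43ab0000001ff17547fccab15f231d000000000000000000015e23ab7fd59503daa6657b1178bde9515795178bf39510000000bf58ca0000001fda3ac00000000000000000000000000000000000000000000015d439d7f78a955d632b00000000000000000001fce76200000015e239d00000000000007fcca955f232b0000001ff17620000000bf58d157951ccbf394a57b11ccbde94a7fd59883daa7400000000000006f79531fcc79500000000000007f70e557d632b00000000000007f39c540000005750bb80000005754e8dfde32a7fcea315ea8ce0f75438bdcca9578ab380000002fd1aa4bf4a5a57d1a34bde5612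f6b4a45d69592795e455e3ab15795e44bf270d00000015d42f57f78c555d636300000000000000000001fce72a00000000000005f50eadfdc3aa00000000000007f31ea9bde561578ea389e67512fc9ca55e67512f59d855f46a91799564bdad0d00000015e2af12fd294cbf468d57aa3c5ff3aa12f732343dd531000000000000000000000000006fcd531fe17957f8ce557f232b7f7aa315d58ce5752b380000000fad438be3ca92f99aa4be6a5a00000000000005788bb80000007fc5c5400000057a8e8dff332a5799a34bf356127b1e455e3ca92f4f4a45f295957b1e44bd670d00000015e22f500000000000007fccc555f23630000001ff172a578f2349f47512fc9d855e66a92f59ca55f475117d1564bd3d0d000000000000000000000000005f88eadfe33aa7f85ea9bf356100000015d4af157563c5fdeaa12f9a94cbe668d2f8f2343eb5310000001fda98d7f716357d6b0b7f8d6357f2b0b5fd542c1e358d00000015d4b8b575662dfdeb0a2f9aa64be666a2f8f1a83eb58c00000015e2b8b2fd2a64bf466a57aa62dff3b0a2f731a83dd58c0000000bf588b5795664bf385557b1664bde8557fd5c443daba10000000bf5899579562cbf386a57b162cbde86a7fd5c283dab8c00000015e2b992fd2a2cbf465557aa665ff3b112f731543dd5a100000015d4b995756665fdeb112f9aa2c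be66552f8f1543eb5a10000001fda9a97f716a57d6b197f8d6a57f2b195fd54641e35a900000000000000000001fcead40000001ff1ad47fd4b503da366000000000000000000000000007fcd1b15f285d57d1174bdeb1100000000000007f791b15d685d00000000000005799174bf3b110000001fdac6500000015d4c6b00000015e2c6b0000000bf570a0000001fdac6c00000015d4c5d00000015e2c5d0000000bf571100000000000007f791955d686b000000000000057991acbf3b0a000000000000000000000000007fcd1955f286b57d11acbdeb0a00000000000000000001fceae20000001ff1ae27fd4b883da374000000000000000000000000007fcd5315f28cd57d1334bdeaa16f7aa31fcccd57f3a3540000000f76238bdc5a92f6a6a45d6b19000000000000057519b80000005789d3800000027973455e35717f731557d686b575718dfde86a2fd13a4bf435a5797344bf28cd00000015d46750000000000000578d5389e6ad100000015e27717f7a1555d6a635f531adfdcc6a2fca3a55e6ad12fd0d4cbf44cd000000000000000000000000002f5ab855f44e957ca3a5ff35610000001fce8ea7f333a9bdeaa1179aa64bda98d2f716343dd8b100000000000007f795315d68cd00000000000005799334bf3aa100000000000005751d3800000057899b800000027b33455e35a96fcea31fe1cd50fae238be35a97fc63540000002f4e6a45f2b197f8f1557f286b2f993a4be635a57ab18d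ff386a57b3344bd68cd00000015e2675578d6349f4ad1000000000000000000015d477100000000000002fcab855e64e90000000000000575a3a5fde5617fce1555f2a632f5a3a55f4ad15f8b1adfe3c6a2f98d4cbe64cd0000001ff18ea17d2a64bd398d7f873a9bf3aa12f8d6343eb8b10000001fdad0d00000015d4d4b00000015e2d4b0000000bf550b7f732357d694b575742dfde94a2fd1564bf42ea5797264bf285d7f8f2357f294b2f99564be62ea57ab42dff394a57b3264bd685d5fd622c1e3c8d2f8cea83ebc8c2f70ea83ddc8c7fd63443dad610000000bf551900000015e2d5900000015d4d590000001fdad29579722cbf286b2fd152cbf42d55757465fde9517f732a57d695957b322cbd686b57ab465ff39512f9952cbe62d57f8f2a57f29597fd63283dad4c2f70e543ddca12f8ce543ebca15fd62641e3ca90000001fdad4c00000015d4ccd00000015e2ccd0000000bf56a100000015d478d0000000000000578d1b89ee8d100000015e27a900000015e278d578d1d49f58d1000000000000000000015d47a90000000bf54e100000015e2ce900000015d4ce90000001fdad616fd5a303ec68e7f98b54be27a97fd0b54bd47a900000005f55197f99954be2ce95fd11acbe1d5a57b918d5ee8d17fd19a8bd4ccd7fd1954bd4ce957d518d5f58d1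5f991acbe1d537f999a8be2ccd00000005f58997fd0ba8bd478d7f98ba8be278d6fd5a843ec6b100000000000007f794355d694b0000000000000579952cbf2b0b7f7a2355d6b0b5f5352dfdcd4a2fca5655e6a992fd0aacbf445d00000000000002fcac655e65590000000000000575a565fde529579aa2cbf294b2fd11acbf429d575ac65fde8a97f735457d4d597f99a34be2d595fd152cbe1cea57b942d5ee8997fd1d28bd4c5d5fd2a2cbe17aa0799a343ee68c2f50eadff4ad10f7aa303de56157ba22d5ee5192f531adff47512f8b52dfe66a92f873557f45597fd2b28bd439d0f795303deaa12f85e557f4a990fb9a841e66a9000000000000000000000000007fcd4355f294b57d152cbd6b0b000000000000000000000000002f5ac655f455957ca565ff35297fce2355f2b0b2f5a5655f4a995f8b52dfe3d4a2f98aacbe645d57d2a2cbd694b57cac65ff38a92f991acbe629d7f8f5457e2d597fd1a34bd4d5957d542d5f58995f9952cbe1cab7f99d28be2c5d57d622d5f55192f5352dff46a92f8b1adfe67512f872757e65595f9aa2cbe15ab2f88eadfe6ad107d1a343f568c0fcea303f35617f9ab28be239d2f856757e6a990fcd5303f3aa10fd5a841f46a900000000000000000001fceb1a0000001ff1b1a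7fd4c683da3ac0000001fce95a7f33569bdeb11179ab44bda8752f711d43dd9910000001ff195a17d2b44bd38757f87569bf3b112f8d1d43eb9917fd61683dac6c2f70ad43ddd112f8cad43ebd115fd63441e3d5100000005f58d17fd0d68bd46757f98d68be26756fd5c443ec7917fd2968bd42f50f791b03deb112f85ad57f4ad10fb9c441e67517f9a968be22f52f853d57e6ad10fcd1b03f3b110fd5c441f47516fd63443eccd10fba3441e6ad10fd63441f4ad107d6344000000

set_option maxRecDepth 100000 in
theorem check0 : ∀ b123 b124 b125 b134 b135 b145 b234 b235 b245 b345 : Bool,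
    go (leafOK certN0 (idxOf b123 b124 b125 b134 b135 b145 b234 b235 b245 b345))
      (flagged b123 b124 b125 b134 b135 b145 b234 b235 b245 b345
        false false false false false false false false false false) 10 [] = true := by
  decide +kernel

def certN1 : ℕ :=
  0x5cd517dde346e000000000000000000000000000000000000000000000000000000000000000000000000000000000000000000000000000000000000000000000000000000000000000000000000000000000000000000000000000000000000000000000000000000000000000000000000000000000000000000000000000000000000000000000000000000000000000000000000000000000000000000000000000000000000000000000000000000000b0ad5f0000000eee9d1000000000000000000000000000000000eeef1174f5178d4afa30000000000000000000000000000000000000000000000000000000000000000000000000000000000000000000000000000000000000000000000000000000000000000000000000000000000000000000000000000000000000000000000000000000000000000000000000000000000000000000000000000000000000000000000000000000000000000b11d5f00000000000000000000ef59d1000000000000000000000000000000000000000000000000000000000000000000000000ef5f11000000000000074bd178d51fa300000000000000000000000000000000000000000000000000000000000000000000000000000000000000000000000000000000000000000000000000000000000000000000000000000000000000000000000000000000000000000000000000000000000000007cd5a3c00000000000000000000000000000000000000000000000000000000000000000d5afa100000000000000000000000000000000000000000000000000000000000d53fa100000000000000000000000000000000000000000000000000008cf9174000000000000000000000000000000000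0000000000000000000000000000000000000000000000000000000000000000000000000000000000000000000000000000000000000000000000000000000007cd595c00000000000000000000000000000000000000000000000000000000000000000000000000000000000000000000000000000000000000000000000000000000000000000000000000000000000000000000000000000000000000000000000000000000000000000000000000000000000000000000000084d517c0000000000000000000000000000000000000000000000000000000000000000000000000000000000000000000000000000000000000000000000000000000000b11cef00000000000000000000ef58b900000000000000000000d5af31000000000000000000000000000000000000000000000000000000000000000000000000000000000000000000000000021d43ab00000000000000000000000000000000000000000000011a237b00000011943eb00000013da971000000000000000000011a3f4a000000000000084dca750eef110000000000000000000000000000000000000000000000000000000000000000000000000000000000000b0acef0000000eee8b90000000000000000000000000000000000000000000000000000000000000000000000000000000000000d53f3100000000000000000000000000000000000000000000000000000000000000000000000000000000000011a23eb000000119437b00000013da9a90000000000000000000000000000000021e23ab000000000000000000000000000000000000000000000119cf4a84f8a750f5f110000000000000000000000000000000000000005cd533dde354e000000000000000000000000000000000eeeea174f5338d4af3300000000000000000000ef5ea1000000000000074bd338d51f330000000000000000000000000000000000000008cf933400000000000000000000000000000000000000000000084d533c000000000000000000000000011a3e6a000000000000084dcb550eeea100000000000000000000000000000000119ce6a84f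8b550f5ea1000000000000000000000000000000000000000678ceaa1e33aa0000000000000000000000000000000000000007cd4b5c00000000000000000000000000000000000000000000000000000000000000000000000000000000000000000000000000000000000000000000000000000000000000000000000000000000000000000000000000000000000000000000000000000000000000000000000000000000000000000000000000000000000000000000000000000000000000000000000000000000000000000000000000000000000000000000000000000000000000000000084d4a7c0000000000000000000000000000000000000000000000000000000000000000000000000000000000000000000b117af0000000d5a9f10000000000000000000000000000000000000000000000000000000000000000000000000000000000000ef553900000000000000000000000000000000000000000000000000000000000000000000000000000000000021d4c6b00000011a2a7b00000011a3bca000000000000000000000000000000001194e6b00000000000000000000000000000000000000000000013dab3184dd1750ee9d10000000000000000000000000000000000000000000000000000000000000000000000000000000000000000000000000000000000000000000000000000b0a7af00000000000000000000d539f100000000000000000000eee539000000000000000000000000000000000000000000000000000000000000000000000000000000000000000000000000011a2e6b0000000000000000000000000000000000000000000001194a7b00000021e2c6b000000119cbca000000000000000000013dad29000000000000084f91750f59d10000000000000000000000000000000000000000000000000000000000000000000000000000000000000ef55e1000000000000000000000000000000000eee5e1000000000000000000000000005cd5a3dde3a8e74f5a38d4a9f374bda38d519f38cf9a3400000000000000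00000000000000000000000000000000000000000000000000000000000000011a33ea0000000000000000000000000000000000000000000000000000000000119c3ea000000000000084d5a3c00000084dd9550ee5e184f99550f55e1678f1aa1e3c6a00000000000000000000000000000000000000000000000000000000000000000000000000000000000000000000000000000000000000000000000000000000000000000000000000000000000000000000000000000000000000000000000000000000000000006eb1a3c00000000000000000000000000000000000000000000000000000000000000001df446b00000000000000000000000000000000000000000000000000000000001de646b000000000000000000000000000000000000000000000000000074f91740000000000000000000000000000000000000000000000000000000000000000000000000000021d4d4b00000011a2bcb00000011a3a7a000000000000000000011a2f4b00000000000000000000000000000000000000000000011a337a0000000000000000000000000000000000000000000001df454b000000000000000000000000000000001df4a8b6ebda3036768e0000000d599f27cdcb54b177a900000000000000000000d59f320000000d4bfa20000000f59f3200000000000007cdd954b17ce90000000f599f25e9d1acb0fd5a0000000000000000000000000000000000000000000000000000000000000000000000000000000000001194f4b000000000000000000000000000000001194bcb00000021e2d4b000000119ca7a00000000000000000000000000000000119c37a0000000000000000000000000000000000000000000001de654b000000000000000000000000000000000d59fa20000000d4bf320000000f59fa20000001de6a8b0000000d4b9f26ef5a3037c68e7cf8b54b3a7a900000000000000000000f5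9de27cf9954b3ace95ef11acb39d5a00000000000000000000000000000000000000084d4b5c0000000000000000000000000000000000000013daba184dd3350ee8b9000000000000000000013dad61000000000000084f93350f58b984d595c00000084dda350ee53984f9a350f5539678f52a1e3d4a00000000000000000000000000000000000000074f933400000000000000000007cdda34b17d590000000f599ba5e9d52cb0fcea00000000000000000000f59d3a7cf9a34b3ad595ef152cb39cea74f9a340000005e9ea2cb0f7aa5ef2a2cb397aa04f9a3437e68c

set_option maxRecDepth 100000 in
theorem check1 : ∀ b123 b124 b125 b134 b135 b145 b234 b235 b245 b345 : Bool,
    go (leafOK certN1 (idxOf b123 b124 b125 b134 b135 b145 b234 b235 b245 b345))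
      (flagged b123 b124 b125 b134 b135 b145 b234 b235 b245 b345
        true true false false true false false false false false) 10 [] = true := by
  decide +kernel

def certN2 : ℕ :=
  0x7e8cabc00000000000000000000000000000000000000000000000000000000000000000000000000000000000000000000000000000000000000000000000000000000000000000000000000000000000000000000000000000000000000000000000000000000000000000000000000000000000000000000000000000000000000000000000000000000000000000000000000000000000000000000000000000000000000000000000000000000000000000000000000000000000000000000000000000000000000000000000000000000000000000000000000000000000000000000000aa674f0000000cef9910000000000000000000000000000000000000000000000000000000000000000000000000000000000000000000000000000000000000000000000000000000000000000000000000000000000000000000000000000000000000000000000000000000000000000000000000000000000015aa31f000000000000000000000000000000000000000000000000000000000000000000000000000000000000000000000000000000000000000000000000000000000000000000000000000000000000000000000000000000000000000000000000000000000000000000000000000000000000000000000000000000000000000000000000000000000000000000000000000000000000000000000000000000000000000000000000000000000000000000000000000000000000000000000000000000000000000000000000000000000000000000000000000000000056b1a3c00000000000000000000000000000000000000000000000000000000000000000000000000000000000000000000000000000000000000000000000000000000010ac3de0000000000000000000000000000000000000000000000000000000000000000000000000000000000000000000000000000000000000000000000000000000000000000000000000000000000000000000000000000000000000000000000000000000000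00000000000000000000000000000000000000000000000000000000000000000000000000000000000000000000000000000000000000000000000000000000000000000000000000000000000000000000000000000000000000000000000000000000000000000000000000000000000000000000000000000000000000000000000000000000000000000000000000000000000000000000000000000000000000000000000000000000000000000000000000000000000000000000000000000000000000000005ac4cf000000000000000000012f2367000000000000000000000000000000000000000000000000000000000000000000000000000000000000000000000000000000000000000000000000000000000000000000000000000000000000000000000000000000012f446f0000000d177a900000006ef991000000000000000000000000000000001fa175700000000000000000000000000000000000000000000000000000000000000000000000000000000000000000000000000000000000000000000000000000000000000000000000000000000000000000000000000000000000000000000000000000000000000000000000000000000000000000000000000000000000000000000000000000000000000000000000000000000000000000000000000000000000000000000000000000000000000000000021a157b000000000000000000000000000000000000000000000000000000000000000000000000000000000000000000000000000000002a8f1bcceceb10000000000000000000000000000000000000000000000000000000000000000000000012f294f0000000000000344fdc46eceb100000000000000000000000000000000000000000000000000000000000000000000000000000000000000000004550eec0000000000000000000000000000000000000000000008688fac00000000000000000000000000000000000000115f8724573e292fd88e000000000000000000000000000000000000000000000000000000000000000000000000000000000000000000055d117c0000000000000000000000000000000000000000000000000000000000000000000000000000000000000000000000000000000000000000000000000000000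000000000000000000000000000000000000000000000000000000000000000000000000000000000000000000000000000000000000000000000000000000000000000000000000000000000000000000000000000000000000000000000000000000000000000000000000000000015728cf0000000000000000000000000000000000000000000000000000000000000000000000000000000000000000000000000000000000000000000000000000000000000000000000000000000000000000000000000000000000000000000000000000000000000000000000000000000000000000000000000000000000000000000000000000000000000000000000000000000000000000000000000000000000000000000000000000000000000000000001157873000000000000000000000000000000000000000000000000000000000000000000000000000000000000000000000000000000000000000000000000000000000000000000000000000000000000000000000000000000000000000000000aa635f000000000000000000010ac7ce000000000000000000000000000000000000000000000000000000000000000000000000000000000000000000000000000000000000000000000000000000000000000000000000000000000000000000000000000000010af70e0000001d62e730000000caf39c000000000000000000000000000000000000000000000000000000000000000000000000000000000000000000000000000000007e8ea3c00000000000000000000000000000000000000000000000000000000000000000cef5a100000000000000000000000000000000000000000000000000000000000000000000000000000000000000000000000000000000000000000000000000000000000000000000000000000000000000000000000008f8b1ac000000000000000000000000000000000000000caf78c0000000000000000000000000000000000000000000000000000000000000000000000000000000000000000000000000000000000000000000000000000000000000000000000000000000000000000000000000000000000000000000000000000000000000000000000000000000000000000000000000000000000000000000000000000000007e9595c0000000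0000000000000000000000000000000000000000000000000000000000000000000000000000000000000000000000000000000000000000000000000021a547b0000000000000000000000000000000000000000000000000000000000000000000000000000000000000000000000000000000000000000000000000000000000000000000000000000000000000000000000000000000000000000000012f588f0000000000000000000000000000000000000000000000aa1cef000000000000000000010ab87e00000000000000000000ceaf310000000000000000000000000000000000000000000000d15ef10000000000000869caad15ef0a000000000000000000006eaf3100000010b43dd00000012fa94e00000000000000000000000000000000000000000000000000000000000000000000000000000000000000000000000000000000000000000000000000000000000000000000000000000000000000000000000000000000d17b9900000021a1f5300000010b770d00000000000000000000000000000000000000000000000000000000000000000000000000000000000023e654b0000000000000000000000000000000000000000000001fb97547eecab15ba31d00000021a5e5300000010b47cd7ef59502faa6655f1178afe95100000000000000000000000000000000000000000000000000000000000000000000000000000000000000000004553e2c000000000000000000000000000000000000000000000868af2c000000000000000000000000006ef5a100000000000004570ee92fc46e00000000000000000001156f0b0000000000000759d62cca9ef400000000000000000000000000000000000000032af9d00000000000000000000869ea2d0b387d7eeea3157a8ce0bf5438afcca9000000000000000000012fa36656f1a34afe5612beb4a44be959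

set_option maxRecDepth 100000 in
theorem check2 : ∀ b123 b124 b125 b134 b135 b145 b234 b235 b245 b345 : Bool,
    go (leafOK certN2 (idxOf b123 b124 b125 b134 b135 b145 b234 b235 b245 b345))
      (flagged b123 b124 b125 b134 b135 b145 b234 b235 b245 b345
        true false true false true false false true false false) 10 [] = true := by
  decide +kernel


/-! ### From families of triples to the computation -/

/-- The thirty-five triples of `{0, …, 6}`. -/
def tris35 : List (ℕ × ℕ × ℕ) :=
  [(1, 2, 3), (1, 2, 4), (1, 2, 5), (1, 3, 4), (1, 3, 5),
   (1, 4, 5), (2, 3, 4), (2, 3, 5), (2, 4, 5), (3, 4, 5),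
   (1, 2, 6), (1, 3, 6), (1, 4, 6), (1, 5, 6), (2, 3, 6),
   (2, 4, 6), (2, 5, 6), (3, 4, 6), (3, 5, 6), (4, 5, 6),
   (0, 1, 2), (0, 1, 3), (0, 1, 4), (0, 1, 5), (0, 1, 6),
   (0, 2, 3), (0, 2, 4), (0, 2, 5), (0, 2, 6), (0, 3, 4),
   (0, 3, 5), (0, 3, 6), (0, 4, 5), (0, 4, 6), (0, 5, 6)]

def toSet (t : ℕ × ℕ × ℕ) : Finset ℕ := {t.1, t.2.1, t.2.2}

/-- The triangles of the model with bit mask `m`. -/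
def modelF (m : ℕ) : Finset (Finset ℕ) :=
  ((range 512).filter fun k => Nat.testBit m k = true).image
    fun k => {k / 64, k / 8 % 8, k % 8}

theorem go_sound (leaf : List (ℕ × ℕ × ℕ) → Bool) (y : ℕ × ℕ × ℕ → Bool) :
    ∀ (l : List (ℕ × ℕ × ℕ)) (fuel : ℕ) (acc : List (ℕ × ℕ × ℕ)),
      go leaf (l.map fun t => (y t, t)) fuel acc = true → (l.filter y).length ≤ fuel →
      leaf ((l.filter y).reverse ++ acc) = true := by
  intro l
  induction l with
  | nil => intro fuel acc h _; simpa [go] using h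
  | cons t l ih =>
    intro fuel acc h hl
    cases hy : y t with
    | false =>
      simp only [List.map_cons, hy, go] at h
      rw [List.filter_cons_of_neg (by simp [hy])] at hl ⊢
      exact ih _ _ h hl
    | true =>
      rw [List.filter_cons_of_pos hy] at hl ⊢
      cases fuel with
      | zero => simp at hl
      | succ k =>
        simp only [List.map_cons, hy, go] at h
        have := ih k (t :: acc) h (by simpa using hl)
        simpa using this

theorem certOK_sound {c : ℕ} {L : List (ℕ × ℕ × ℕ)} (h : certOK c L = true) :
    ∃ m n, (m, n) ∈ modelTab ∧ L.length = n ∧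
      (∀ t ∈ L, (toSet t).image (cmap c) ∈ modelF m) ∧
      Set.InjOn (cmap c) (range 7 : Finset ℕ) := by
  unfold certOK at h
  split at h
  · simp at h
  · rename_i m n hmn
    simp only [Bool.and_eq_true, List.all_eq_true] at h
    obtain ⟨h1, h2, h3⟩ := h
    refine ⟨m, n, List.mem_of_getElem? hmn, Nat.eq_of_beq_eq_true h2, ?_, ?_⟩
    · intro t ht
      have h := h1 t ht
      have b : ∀ v, cmap c v < 8 := fun v => Nat.mod_lt _ (by norm_num)
      have b1 := b t.1
      have b2 := b t.2.1
      have b3 := b t.2.2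
      refine Finset.mem_image.2 ⟨64 * cmap c t.1 + 8 * cmap c t.2.1 + cmap c t.2.2, ?_, ?_⟩
      · rw [Finset.mem_filter, Finset.mem_range]
        exact ⟨by omega, h⟩
      · have e1 : (64 * cmap c t.1 + 8 * cmap c t.2.1 + cmap c t.2.2) / 64 = cmap c t.1 := by omega
        have e2 : (64 * cmap c t.1 + 8 * cmap c t.2.1 + cmap c t.2.2) / 8 % 8 = cmap c t.2.1 := by
          omega
        have e3 : (64 * cmap c t.1 + 8 * cmap c t.2.1 + cmap c t.2.2) % 8 = cmap c t.2.2 := by omega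
        rw [e1, e2, e3]
        simp [toSet, Finset.image_insert]
    · have key : ∀ a ∈ range 7, ∀ b ∈ range 7, a < b → cmap c a ≠ cmap c b := by
        intro a ha b hb hab he
        have hp : ∀ a ∈ range 7, ∀ b ∈ range 7, a < b → (a, b) ∈ pairs7 := by decide
        have := h3 _ (hp a ha b hb hab)
        simp [he] at this
      intro a ha b hb he
      rcases lt_trichotomy a b with hab | hab | hab
      · exact absurd he (key a ha b hb hab)
      · exact hab
      · exact absurd he.symm (key b hb a ha hab)

/-- Parity of a filtered list as an iterated exclusive or. -/
theorem foldr_xor (p : ℕ → Bool) (l : List ℕ) :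
    Even (l.filter p).length → l.foldr (fun c r => (p c ^^ r)) false = false := by
  have : ∀ l : List ℕ, l.foldr (fun c r => (p c ^^ r)) false = decide (Odd (l.filter p).length) := by
    intro l
    induction l with
    | nil => simp
    | cons a l ih =>
      rw [List.foldr_cons, ih]
      cases h : p a with
      | false => simp [h]
      | true =>
        simp only [h, Bool.true_xor, List.filter_cons_of_pos, List.length_cons, Nat.odd_add_one]
        by_cases ho : Odd (l.filter p).length <;> simp [ho]
  intro h
  rw [this]
  simpa using h

theorem parity_xor (T : Finset (Finset ℕ)) (hT : ∀ t ∈ T, t ⊆ range 7 ∧ t.card = 3)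
    (heven : ∀ s : Finset ℕ, s.card = 2 → Even (T.filter fun t => s ⊆ t).card) (a b : ℕ)
    (hab : a ≠ b) :
    ((List.range 7).filter fun c => c ≠ a ∧ c ≠ b).foldr
      (fun c r => (decide (({a, b, c} : Finset ℕ) ∈ T) ^^ r)) false = false := by
  apply foldr_xor (fun c => decide (({a, b, c} : Finset ℕ) ∈ T))
  have h := heven {a, b} (Finset.card_pair hab)
  convert h using 1
  set l := (((List.range 7).filter fun c => c ≠ a ∧ c ≠ b).filter
    fun c => decide (({a, b, c} : Finset ℕ) ∈ T)) with hl
  have hnd : l.Nodup := (List.nodup_range.filter _).filter _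
  have hmem : ∀ c, c ∈ l ↔ c < 7 ∧ c ≠ a ∧ c ≠ b ∧ ({a, b, c} : Finset ℕ) ∈ T := by
    intro c
    simp only [hl, List.mem_filter, List.mem_range, decide_eq_true_eq]
    tauto
  rw [← List.toFinset_card_of_nodup hnd]
  refine Finset.card_bij (fun c _ => ({a, b, c} : Finset ℕ)) ?_ ?_ ?_
  · intro c hc
    rw [List.mem_toFinset, hmem] at hc
    rw [Finset.mem_filter]
    refine ⟨hc.2.2.2, ?_⟩
    intro z hz
    simp only [Finset.mem_insert, Finset.mem_singleton] at hz ⊢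
    tauto
  · intro c hc d hd he
    rw [List.mem_toFinset, hmem] at hc hd
    have : c ∈ ({a, b, d} : Finset ℕ) := by rw [← he]; simp
    simp only [Finset.mem_insert, Finset.mem_singleton] at this
    tauto
  · intro t ht
    rw [Finset.mem_filter] at ht
    obtain ⟨h7, h3⟩ := hT t ht.1
    have hc1 : (t \ {a, b}).card = 1 := by
      rw [Finset.card_sdiff_of_subset ht.2, h3, Finset.card_pair hab]
    obtain ⟨c, hc⟩ := Finset.card_eq_one.1 hc1
    have hct : c ∈ t \ {a, b} := by rw [hc]; simp
    have hte : ({a, b, c} : Finset ℕ) = t := by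
      have := Finset.union_sdiff_of_subset ht.2
      rw [hc] at this
      rw [← this]
      ext z
      simp only [Finset.mem_insert, Finset.mem_singleton, Finset.mem_union]
      tauto
    simp only [Finset.mem_sdiff, Finset.mem_insert, Finset.mem_singleton, not_or] at hct
    refine ⟨c, ?_, hte⟩
    rw [List.mem_toFinset, hmem, hte]
    exact ⟨Finset.mem_range.1 (h7 hct.1), hct.2.1, hct.2.2, ht.1⟩

theorem flagged_eq (T : Finset (Finset ℕ)) (hT : ∀ t ∈ T, t ⊆ range 7 ∧ t.card = 3)
    (heven : ∀ s : Finset ℕ, s.card = 2 → Even (T.filter fun t => s ⊆ t).card)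
    (X : ℕ → ℕ → ℕ → Bool) (hX : ∀ a b c, X a b c = decide (({a, b, c} : Finset ℕ) ∈ T)) :
    flagged (X 1 2 3) (X 1 2 4) (X 1 2 5) (X 1 3 4) (X 1 3 5) (X 1 4 5) (X 2 3 4) (X 2 3 5) (X 2 4 5) (X 3 4 5)
      (X 1 2 6) (X 1 3 6) (X 1 4 6) (X 1 5 6) (X 2 3 6) (X 2 4 6) (X 2 5 6) (X 3 4 6) (X 3 5 6) (X 4 5 6)
      = tris35.map fun t => (X t.1 t.2.1 t.2.2, t) := by
  have s1 : ∀ a b c, X a b c = X b a c := by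
    intro a b c
    rw [hX, hX, Finset.insert_comm]
  have s2 : ∀ a b c, X a b c = X a c b := by
    intro a b c
    rw [hX, hX, Finset.pair_comm]
  have par : ∀ a b, a ≠ b → ((List.range 7).filter fun c => c ≠ a ∧ c ≠ b).foldr
      (fun c r => (X a b c ^^ r)) false = false := by
    intro a b hab
    have := parity_xor T hT heven a b hab
    simpa only [hX] using this
  have xx : ∀ p q r s t : Bool, (p ^^ (q ^^ (r ^^ (s ^^ (t ^^ false))))) = false →
      (q ^^ (r ^^ (s ^^ t))) = p := by decide
  have h12 : ((X 1 2 3) ^^ ((X 1 2 4) ^^ ((X 1 2 5) ^^ (X 1 2 6)))) = X 0 1 2 := by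
    have h := xx _ _ _ _ _ (par 1 2 (by decide))
    simpa only [s1, s2] using h
  have h13 : ((X 1 2 3) ^^ ((X 1 3 4) ^^ ((X 1 3 5) ^^ (X 1 3 6)))) = X 0 1 3 := by
    have h := xx _ _ _ _ _ (par 1 3 (by decide))
    simpa only [s1, s2] using h
  have h14 : ((X 1 2 4) ^^ ((X 1 3 4) ^^ ((X 1 4 5) ^^ (X 1 4 6)))) = X 0 1 4 := by
    have h := xx _ _ _ _ _ (par 1 4 (by decide))
    simpa only [s1, s2] using h
  have h15 : ((X 1 2 5) ^^ ((X 1 3 5) ^^ ((X 1 4 5) ^^ (X 1 5 6)))) = X 0 1 5 := by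
    have h := xx _ _ _ _ _ (par 1 5 (by decide))
    simpa only [s1, s2] using h
  have h16 : ((X 1 2 6) ^^ ((X 1 3 6) ^^ ((X 1 4 6) ^^ (X 1 5 6)))) = X 0 1 6 := by
    have h := xx _ _ _ _ _ (par 1 6 (by decide))
    simpa only [s1, s2] using h
  have h23 : ((X 1 2 3) ^^ ((X 2 3 4) ^^ ((X 2 3 5) ^^ (X 2 3 6)))) = X 0 2 3 := by
    have h := xx _ _ _ _ _ (par 2 3 (by decide))
    simpa only [s1, s2] using h
  have h24 : ((X 1 2 4) ^^ ((X 2 3 4) ^^ ((X 2 4 5) ^^ (X 2 4 6)))) = X 0 2 4 := by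
    have h := xx _ _ _ _ _ (par 2 4 (by decide))
    simpa only [s1, s2] using h
  have h25 : ((X 1 2 5) ^^ ((X 2 3 5) ^^ ((X 2 4 5) ^^ (X 2 5 6)))) = X 0 2 5 := by
    have h := xx _ _ _ _ _ (par 2 5 (by decide))
    simpa only [s1, s2] using h
  have h26 : ((X 1 2 6) ^^ ((X 2 3 6) ^^ ((X 2 4 6) ^^ (X 2 5 6)))) = X 0 2 6 := by
    have h := xx _ _ _ _ _ (par 2 6 (by decide))
    simpa only [s1, s2] using h
  have h34 : ((X 1 3 4) ^^ ((X 2 3 4) ^^ ((X 3 4 5) ^^ (X 3 4 6)))) = X 0 3 4 := by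
    have h := xx _ _ _ _ _ (par 3 4 (by decide))
    simpa only [s1, s2] using h
  have h35 : ((X 1 3 5) ^^ ((X 2 3 5) ^^ ((X 3 4 5) ^^ (X 3 5 6)))) = X 0 3 5 := by
    have h := xx _ _ _ _ _ (par 3 5 (by decide))
    simpa only [s1, s2] using h
  have h36 : ((X 1 3 6) ^^ ((X 2 3 6) ^^ ((X 3 4 6) ^^ (X 3 5 6)))) = X 0 3 6 := by
    have h := xx _ _ _ _ _ (par 3 6 (by decide))
    simpa only [s1, s2] using h
  have h45 : ((X 1 4 5) ^^ ((X 2 4 5) ^^ ((X 3 4 5) ^^ (X 4 5 6)))) = X 0 4 5 := by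
    have h := xx _ _ _ _ _ (par 4 5 (by decide))
    simpa only [s1, s2] using h
  have h46 : ((X 1 4 6) ^^ ((X 2 4 6) ^^ ((X 3 4 6) ^^ (X 4 5 6)))) = X 0 4 6 := by
    have h := xx _ _ _ _ _ (par 4 6 (by decide))
    simpa only [s1, s2] using h
  have h56 : ((X 1 5 6) ^^ ((X 2 5 6) ^^ ((X 3 5 6) ^^ (X 4 5 6)))) = X 0 5 6 := by
    have h := xx _ _ _ _ _ (par 5 6 (by decide))
    simpa only [s1, s2] using h
  simp only [flagged, tris35, List.map_cons, List.map_nil, h12, h13, h14, h15, h16, h23, h24, h25, h26, h34, h35, h36, h45, h46, h56]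

theorem core (T : Finset (Finset ℕ)) (hT : ∀ t ∈ T, t ⊆ range 7 ∧ t.card = 3)
    (heven : ∀ s : Finset ℕ, s.card = 2 → Even (T.filter fun t => s ⊆ t).card)
    (hne : T.Nonempty) (h10 : T.card ≤ 10)
    (hl : (T.filter fun t => 6 ∈ t) = ∅ ∨
      (T.filter fun t => 6 ∈ t) = {{1, 2, 6}, {2, 3, 6}, {1, 3, 6}} ∨
      (T.filter fun t => 6 ∈ t) = {{1, 2, 6}, {2, 3, 6}, {3, 4, 6}, {1, 4, 6}}) :
    ∃ (m n : ℕ) (f : ℕ → ℕ), (m, n) ∈ modelTab ∧ T.card = n ∧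
      Set.InjOn f (range 7 : Finset ℕ) ∧ ∀ t ∈ T, t.image f ∈ modelF m := by
  obtain ⟨X, hX⟩ : ∃ X : ℕ → ℕ → ℕ → Bool,
      ∀ a b c, X a b c = decide (({a, b, c} : Finset ℕ) ∈ T) := ⟨_, fun _ _ _ => rfl⟩
  have hfl := flagged_eq T hT heven X hX
  set y : ℕ × ℕ × ℕ → Bool := fun t => X t.1 t.2.1 t.2.2 with hy
  have hyT : ∀ t, y t = true ↔ toSet t ∈ T := by
    intro t
    simp [hy, hX, toSet]
  set L := tris35.filter y with hL
  have hnd : (L.map toSet).Nodup := by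
    have h35 : (tris35.map toSet).Nodup := by decide +kernel
    exact h35.sublist (List.filter_sublist.map _)
  have hall : ∀ t ∈ (range 7).powersetCard 3, ∃ q ∈ tris35, toSet q = t := by decide +kernel
  have hTL : T = (L.map toSet).toFinset := by
    ext t
    rw [List.mem_toFinset, List.mem_map]
    constructor
    · intro ht
      obtain ⟨q, hq, rfl⟩ := hall t (Finset.mem_powersetCard.2 (hT t ht))
      exact ⟨q, List.mem_filter.2 ⟨hq, (hyT q).2 ht⟩, rfl⟩
    · rintro ⟨q, hq, rfl⟩
      exact (hyT q).1 (List.mem_filter.1 hq).2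
  have hcard : T.card = L.length := by
    rw [hTL, List.toFinset_card_of_nodup hnd, List.length_map]
  have hleaf : ∃ N idx, leafOK N idx (L.reverse ++ []) = true := by
    have hlk : ∀ Lk : Finset (Finset ℕ), (T.filter fun t => 6 ∈ t) = Lk →
        ∀ a b, X a b 6 = decide (({a, b, 6} : Finset ℕ) ∈ Lk) := by
      intro Lk h a b
      rw [hX, ← h]
      simp
    rcases hl with h | h | h
    · have k := hlk _ h
      have k12 : X 1 2 6 = false := (k 1 2).trans (by decide)
      have k13 : X 1 3 6 = false := (k 1 3).trans (by decide)
      have k14 : X 1 4 6 = false := (k 1 4).trans (by decide)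
      have k15 : X 1 5 6 = false := (k 1 5).trans (by decide)
      have k23 : X 2 3 6 = false := (k 2 3).trans (by decide)
      have k24 : X 2 4 6 = false := (k 2 4).trans (by decide)
      have k25 : X 2 5 6 = false := (k 2 5).trans (by decide)
      have k34 : X 3 4 6 = false := (k 3 4).trans (by decide)
      have k35 : X 3 5 6 = false := (k 3 5).trans (by decide)
      have k45 : X 4 5 6 = false := (k 4 5).trans (by decide)
      rw [k12, k13, k14, k15, k23, k24, k25, k34, k35, k45] at hfl
      have h := check0 (X 1 2 3) (X 1 2 4) (X 1 2 5) (X 1 3 4) (X 1 3 5) (X 1 4 5) (X 2 3 4) (X 2 3 5) (X 2 4 5) (X 3 4 5)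
      rw [hfl] at h
      exact ⟨_, _, go_sound _ y tris35 10 [] h (by rw [← hL, ← hcard]; exact h10)⟩
    · have k := hlk _ h
      have k12 : X 1 2 6 = true := (k 1 2).trans (by decide)
      have k13 : X 1 3 6 = true := (k 1 3).trans (by decide)
      have k14 : X 1 4 6 = false := (k 1 4).trans (by decide)
      have k15 : X 1 5 6 = false := (k 1 5).trans (by decide)
      have k23 : X 2 3 6 = true := (k 2 3).trans (by decide)
      have k24 : X 2 4 6 = false := (k 2 4).trans (by decide)
      have k25 : X 2 5 6 = false := (k 2 5).trans (by decide)
      have k34 : X 3 4 6 = false := (k 3 4).trans (by decide)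
      have k35 : X 3 5 6 = false := (k 3 5).trans (by decide)
      have k45 : X 4 5 6 = false := (k 4 5).trans (by decide)
      rw [k12, k13, k14, k15, k23, k24, k25, k34, k35, k45] at hfl
      have h := check1 (X 1 2 3) (X 1 2 4) (X 1 2 5) (X 1 3 4) (X 1 3 5) (X 1 4 5) (X 2 3 4) (X 2 3 5) (X 2 4 5) (X 3 4 5)
      rw [hfl] at h
      exact ⟨_, _, go_sound _ y tris35 10 [] h (by rw [← hL, ← hcard]; exact h10)⟩
    · have k := hlk _ h
      have k12 : X 1 2 6 = true := (k 1 2).trans (by decide)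
      have k13 : X 1 3 6 = false := (k 1 3).trans (by decide)
      have k14 : X 1 4 6 = true := (k 1 4).trans (by decide)
      have k15 : X 1 5 6 = false := (k 1 5).trans (by decide)
      have k23 : X 2 3 6 = true := (k 2 3).trans (by decide)
      have k24 : X 2 4 6 = false := (k 2 4).trans (by decide)
      have k25 : X 2 5 6 = false := (k 2 5).trans (by decide)
      have k34 : X 3 4 6 = true := (k 3 4).trans (by decide)
      have k35 : X 3 5 6 = false := (k 3 5).trans (by decide)
      have k45 : X 4 5 6 = false := (k 4 5).trans (by decide)
      rw [k12, k13, k14, k15, k23, k24, k25, k34, k35, k45] at hfl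
      have h := check2 (X 1 2 3) (X 1 2 4) (X 1 2 5) (X 1 3 4) (X 1 3 5) (X 1 4 5) (X 2 3 4) (X 2 3 5) (X 2 4 5) (X 3 4 5)
      rw [hfl] at h
      exact ⟨_, _, go_sound _ y tris35 10 [] h (by rw [← hL, ← hcard]; exact h10)⟩
  obtain ⟨N, idx, hleaf⟩ := hleaf
  rw [List.append_nil] at hleaf
  have hne' : L.reverse ≠ [] := by
    intro h0
    have : L = [] := by simpa using h0
    rw [this] at hcard
    exact hne.card_pos.ne' (by simpa using hcard)
  have hc : ∃ c, certOK c L.reverse = true := by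
    unfold leafOK at hleaf
    split at hleaf
    · rename_i h0
      exact absurd h0 hne'
    · rename_i t ts h0
      exact ⟨_, by rw [h0]; exact hleaf⟩
  obtain ⟨c, hc⟩ := hc
  obtain ⟨m, n, hmn, hlen, hmem, hinj⟩ := certOK_sound hc
  refine ⟨m, n, cmap c, hmn, ?_, hinj, ?_⟩
  · rw [hcard, ← hlen, List.length_reverse]
  · intro t ht
    rw [hTL, List.mem_toFinset, List.mem_map] at ht
    obtain ⟨q, hq, rfl⟩ := ht
    exact hmem q (List.mem_reverse.2 hq)

/-! ### Generated complexes -/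

/-- The complex generated by a family of sets. -/
def gen (F : Finset (Finset V)) : Finset (Finset V) :=
  F.sup fun s => s.powerset.erase ∅

theorem mem_gen {F : Finset (Finset V)} {s : Finset V} :
    s ∈ gen F ↔ s ≠ ∅ ∧ ∃ t ∈ F, s ⊆ t := by
  simp only [gen, Finset.mem_sup, Finset.mem_erase, Finset.mem_powerset]
  constructor
  · rintro ⟨t, ht, h, h'⟩
    exact ⟨h, t, ht, h'⟩
  · rintro ⟨h, t, ht, h'⟩
    exact ⟨t, ht, h, h'⟩

theorem mem_verts {K : Finset (Finset V)} {v : V} : v ∈ verts K ↔ ∃ s ∈ K, v ∈ s := by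
  simp [verts, Finset.mem_sup]

theorem mem_verts_gen {F : Finset (Finset V)} {v : V} : v ∈ verts (gen F) ↔ ∃ s ∈ F, v ∈ s := by
  rw [mem_verts]
  constructor
  · rintro ⟨s, hs, hv⟩
    obtain ⟨_, t, ht, hst⟩ := mem_gen.1 hs
    exact ⟨t, ht, hst hv⟩
  · rintro ⟨s, hs, hv⟩
    exact ⟨s, mem_gen.2 ⟨Finset.ne_empty_of_mem hv, s, hs, subset_rfl⟩, hv⟩

theorem isComplex_gen {F : Finset (Finset V)} (h : ∃ t ∈ F, t ≠ ∅) : IsComplex (gen F) := by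
  obtain ⟨t, ht, hne⟩ := h
  refine ⟨⟨t, mem_gen.2 ⟨hne, t, ht, subset_rfl⟩⟩, fun h => (mem_gen.1 h).1 rfl, ?_⟩
  intro s hs r hr hrn
  obtain ⟨_, u, hu, hsu⟩ := mem_gen.1 hs
  exact mem_gen.2 ⟨hrn.ne_empty, u, hu, hr.trans hsu⟩

theorem gen_image (F : Finset (Finset V)) (f : V → W) :
    (gen F).image (Finset.image f) = gen (F.image (Finset.image f)) := by
  ext s
  rw [Finset.mem_image, mem_gen]
  constructor
  · rintro ⟨t, ht, rfl⟩
    obtain ⟨hne, u, hu, htu⟩ := mem_gen.1 ht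
    exact ⟨by simpa using hne, _, Finset.mem_image_of_mem _ hu, Finset.image_subset_image htu⟩
  · rintro ⟨hne, t, ht, hst⟩
    obtain ⟨u, hu, rfl⟩ := Finset.mem_image.1 ht
    obtain ⟨r, hr, rfl⟩ := Finset.subset_image_iff.1 hst
    refine ⟨r, mem_gen.2 ⟨?_, u, hu, by simpa using hr⟩, rfl⟩
    rintro rfl
    simp at hne

theorem iso_gen (F : Finset (Finset V)) (f : V → W) (hf : Set.InjOn f ↑(verts (gen F)))
    (F' : Finset (Finset W)) (h : F.image (Finset.image f) = F') : Iso (gen F) (gen F') :=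
  ⟨f, hf, by rw [gen_image, h]⟩

theorem verts_image (K : Finset (Finset V)) (f : V → W) :
    verts (K.image (Finset.image f)) = (verts K).image f := by
  ext w
  simp only [mem_verts, Finset.mem_image]
  constructor
  · rintro ⟨s, ⟨t, ht, rfl⟩, hw⟩
    obtain ⟨v, hv, rfl⟩ := Finset.mem_image.1 hw
    exact ⟨v, ⟨t, ht, hv⟩, rfl⟩
  · rintro ⟨v, ⟨t, ht, hv⟩, rfl⟩
    exact ⟨_, ⟨t, ht, rfl⟩, Finset.mem_image_of_mem _ hv⟩

theorem Iso.verts_card {K : Finset (Finset V)} {L : Finset (Finset W)} (h : Iso K L) :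
    (verts K).card = (verts L).card := by
  obtain ⟨f, hf, rfl⟩ := h
  rw [verts_image, Finset.card_image_of_injOn hf]

theorem realizes_of_iso {K : Finset (Finset V)} {L : Finset (Finset W)} (h : Iso K L)
    {G : GComplex} (hG : Realizes G L) : Realizes G K := by
  obtain ⟨f, hf, rfl⟩ := h
  obtain ⟨g, hg, hG⟩ := hG
  refine ⟨g ∘ f, hg.comp hf ?_, ?_⟩
  · intro v hv
    rw [verts_image]
    exact Finset.mem_coe.2 (Finset.mem_image_of_mem _ hv)
  · rw [hG, Finset.image_image]
    congr 1
    funext s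
    simp [Finset.image_image]

theorem combSphere_of_iso {K : Finset (Finset V)} {L : Finset (Finset W)} (h : Iso K L)
    (hL : IsCombSphere 2 L) : IsCombSphere 2 K := by
  obtain ⟨A, hA, G1, G1', G2, G2', h1, h2⟩ := hL
  exact ⟨A, hA, G1, G1', G2, G2', realizes_of_iso h h1, h2⟩

/-! ### Geometric realizations -/

/-- `w` recovers the barycentric coordinates of points in the simplices of `K`. -/
def Bary (K : Finset (Finset ℕ)) (q : ℕ → ℕ → ℝ) (w : (ℕ → ℝ) → ℕ → ℝ) : Prop :=
  ∀ s ∈ K, ∀ c : ℕ → ℝ, (∀ i, 0 ≤ c i) → (∀ i, i ∉ s → c i = 0) → ∑ i ∈ s, c i = 1 →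
    w (∑ i ∈ s, c i • q i) = c

theorem Bary.injOn {K : Finset (Finset ℕ)} (hK : IsComplex K) {q : ℕ → ℕ → ℝ}
    {w : (ℕ → ℝ) → ℕ → ℝ} (h : Bary K q w) : Set.InjOn q ↑(verts K) := by
  have key : ∀ i ∈ verts K, w (q i) = Pi.single i 1 := by
    intro i hi
    obtain ⟨s, hs, his⟩ := mem_verts.1 hi
    have h1 := h {i} (hK.2.2 s hs {i} (by simpa using his) (by simp)) (Pi.single i 1)
      (by intro j; by_cases hj : j = i <;> simp [hj])
      (by intro j hj; simp at hj; simp [hj]) (by simp)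
    simpa using h1
  intro i hi j hj hij
  have := key i hi
  rw [hij, key j hj] at this
  by_contra hne
  have h2 := congrFun this j
  rw [Pi.single_eq_same, Pi.single_eq_of_ne (Ne.symm hne)] at h2
  norm_num at h2

theorem face_subset_verts {K : Finset (Finset V)} {s : Finset V} (hs : s ∈ K) : s ⊆ verts K :=
  fun _ hv => mem_verts.2 ⟨s, hs, hv⟩

theorem mem_hull {q : ℕ → ℕ → ℝ} {s : Finset ℕ} (hq : Set.InjOn q ↑s) {x : ℕ → ℝ} :
    x ∈ convexHull ℝ ((s.image q : Finset (ℕ → ℝ)) : Set (ℕ → ℝ)) ↔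
      ∃ c : ℕ → ℝ, (∀ i, 0 ≤ c i) ∧ (∀ i, i ∉ s → c i = 0) ∧ ∑ i ∈ s, c i = 1 ∧
        ∑ i ∈ s, c i • q i = x := by
  rw [Finset.mem_convexHull']
  constructor
  · rintro ⟨d, h0, h1, h2⟩
    rw [Finset.sum_image hq] at h1 h2
    refine ⟨fun i => if i ∈ s then d (q i) else 0, ?_, ?_, ?_, ?_⟩
    · intro i
      dsimp only
      split_ifs with hi
      · exact h0 _ (Finset.mem_image_of_mem _ hi)
      · exact le_rfl
    · intro i hi
      simp [hi]
    · rw [← h1]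
      exact Finset.sum_congr rfl fun i hi => by simp [hi]
    · rw [← h2]
      exact Finset.sum_congr rfl fun i hi => by simp [hi]
  · rintro ⟨c, h0, -, h1, h2⟩
    refine ⟨fun y => c (Function.invFunOn q s y), fun y _ => h0 _, ?_, ?_⟩
    · rw [Finset.sum_image hq, ← h1]
      exact Finset.sum_congr rfl fun i hi => by
        simp only [hq.leftInvOn_invFunOn hi]
    · rw [Finset.sum_image hq, ← h2]
      exact Finset.sum_congr rfl fun i hi => by
        simp only [hq.leftInvOn_invFunOn hi]

theorem Bary.indep {K : Finset (Finset ℕ)} {q : ℕ → ℕ → ℝ}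
    {w : (ℕ → ℝ) → ℕ → ℝ} (h : Bary K q w) {s : Finset ℕ} (hs : s ∈ K) (hne : s.Nonempty)
    (d : ℕ → ℝ) (hd0 : ∀ i, i ∉ s → d i = 0) (hd : ∑ i ∈ s, d i = 0)
    (hdq : ∑ i ∈ s, d i • q i = 0) : ∀ i, d i = 0 := by
  have hn : (0 : ℝ) < s.card := by exact_mod_cast hne.card_pos
  set M : ℝ := 1 + ∑ i ∈ s, |d i| with hM
  have hS : 0 ≤ ∑ i ∈ s, |d i| := Finset.sum_nonneg fun i _ => abs_nonneg _
  have hMpos : 0 < M := by linarith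
  set c : ℕ → ℝ := fun i => if i ∈ s then (s.card : ℝ)⁻¹ else 0 with hc
  set c' : ℕ → ℝ := fun i => c i + (s.card : ℝ)⁻¹ * (M⁻¹ * d i) with hc'
  have hcs : ∑ i ∈ s, c i = 1 := by
    rw [Finset.sum_congr rfl (g := fun _ => (s.card : ℝ)⁻¹) fun i hi => by simp [hc, hi]]
    simp [hn.ne']
  have e1 := h s hs c (by intro i; simp only [hc]; split_ifs <;> positivity)
    (by intro i hi; simp [hc, hi]) hcs
  have e2 := h s hs c' (by
      intro i
      by_cases hi : i ∈ s
      · have hdi : |d i| ≤ M := by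
          have : |d i| ≤ ∑ i ∈ s, |d i| :=
            Finset.single_le_sum (f := fun i => |d i|) (fun i _ => abs_nonneg _) hi
          linarith
        have h1 : -1 ≤ M⁻¹ * d i := by
          rw [inv_mul_eq_div, le_div_iff₀ hMpos]
          have := neg_abs_le (d i)
          linarith
        have : c' i = (s.card : ℝ)⁻¹ * (1 + M⁻¹ * d i) := by simp only [hc', hc, hi, if_true]; ring
        rw [this]
        exact mul_nonneg (by positivity) (by linarith)
      · simp [hc', hc, hi, hd0 i hi])
    (by intro i hi; simp [hc', hc, hi, hd0 i hi])
    (by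
      simp only [hc', Finset.sum_add_distrib, ← Finset.mul_sum]
      rw [hcs, hd]; simp)
  have hpt : ∑ i ∈ s, c' i • q i = ∑ i ∈ s, c i • q i := by
    simp only [hc', add_smul, Finset.sum_add_distrib, mul_smul, ← Finset.smul_sum]
    rw [hdq]; simp
  rw [hpt, e1] at e2
  intro i
  have h3 := congrFun e2 i
  simp only [hc'] at h3
  have h4 : (s.card : ℝ)⁻¹ * (M⁻¹ * d i) = 0 := by linarith
  simpa [hn.ne', hMpos.ne', hne.ne_empty] using h4

/-- The geometric complex with abstract scheme `K` and vertices `q i`. -/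
def mkG (K : Finset (Finset ℕ)) (hK : IsComplex K) (q : ℕ → ℕ → ℝ)
    (w : (ℕ → ℝ) → ℕ → ℝ) (h : Bary K q w) : GComplex where
  faces := K.image (Finset.image q)
  nonempty := hK.1.image _
  empty_not_mem := by
    intro h0
    obtain ⟨s, hs, hs0⟩ := Finset.mem_image.1 h0
    rw [Finset.image_eq_empty] at hs0
    exact hK.2.1 (hs0 ▸ hs)
  down_closed := by
    intro s hs t ht htn
    obtain ⟨s, hs', rfl⟩ := Finset.mem_image.1 hs
    obtain ⟨r, hr, rfl⟩ := Finset.subset_image_iff.1 ht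
    refine Finset.mem_image_of_mem _ (hK.2.2 s hs' r (by simpa using hr) ?_)
    simpa using htn
  indep := by
    intro s hs
    obtain ⟨s, hs', rfl⟩ := Finset.mem_image.1 hs
    have hq : Set.InjOn q ↑s :=
      (h.injOn hK).mono (Finset.coe_subset.2 (face_subset_verts hs'))
    have hsn : s.Nonempty := by
      rw [Finset.nonempty_iff_ne_empty]
      rintro rfl
      exact hK.2.1 hs'
    have hi : AffineIndependent ℝ (fun i : s => q i) := by
      rw [affineIndependent_iff]
      intro u d hd hdq
      have hu : s.attach ∩ u = u := Finset.inter_eq_right.2 fun i _ => Finset.mem_attach _ _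
      have key := h.indep hs' hsn
        (fun i => if hi : i ∈ s then (if (⟨i, hi⟩ : s) ∈ u then d ⟨i, hi⟩ else 0) else 0)
        (fun i hi => by simp [hi])
        (by
          refine Eq.trans ?_ hd
          rw [← Finset.sum_coe_sort s]
          simp [hu])
        (by
          refine Eq.trans ?_ hdq
          rw [← Finset.sum_coe_sort s]
          simp [hu])
      intro i hi
      have := key i
      simpa [hi] using this
    have hr : ∀ y : {y : ℕ → ℝ // y ∈ s.image q}, y.1 ∈ Set.range (fun i : s => q i) := by
      intro y
      obtain ⟨i, hi, he⟩ := Finset.mem_image.1 y.2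
      exact ⟨⟨i, hi⟩, he⟩
    let em : {y : ℕ → ℝ // y ∈ s.image q} ↪ Set.range (fun i : s => q i) :=
      ⟨fun y => ⟨y.1, hr y⟩, fun y z hyz => Subtype.ext (by simpa using hyz)⟩
    exact hi.range.comp_embedding em
  glue := by
    intro s' hs' t' ht'
    obtain ⟨s, hs, rfl⟩ := Finset.mem_image.1 hs'
    obtain ⟨t, ht, rfl⟩ := Finset.mem_image.1 ht'
    have hq := h.injOn hK
    have hqs : Set.InjOn q ↑s := hq.mono (Finset.coe_subset.2 (face_subset_verts hs))
    have hqt : Set.InjOn q ↑t := hq.mono (Finset.coe_subset.2 (face_subset_verts ht))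
    have hst : s.image q ∩ t.image q = (s ∩ t).image q := by
      rw [Finset.image_inter_of_injOn]
      refine hq.mono ?_
      rw [← Finset.coe_union]
      exact Finset.coe_subset.2 (Finset.union_subset (face_subset_verts hs) (face_subset_verts ht))
    rw [hst]
    ext x
    rw [Set.mem_inter_iff, mem_hull hqs, mem_hull hqt,
      mem_hull (hqs.mono (Finset.coe_subset.2 Finset.inter_subset_left))]
    constructor
    · rintro ⟨⟨c, h0, hz, h1, hx⟩, ⟨c', h0', hz', h1', hx'⟩⟩
      have e := h s hs c h0 hz h1
      have e' := h t ht c' h0' hz' h1'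
      rw [hx] at e
      rw [hx', e] at e'
      subst e'
      have hz2 : ∀ i ∈ s, i ∉ s ∩ t → c i = 0 := by
        intro i hi hit
        apply hz'
        intro h'
        exact hit (Finset.mem_inter.2 ⟨hi, h'⟩)
      refine ⟨c, h0, ?_, ?_, ?_⟩
      · intro i hi
        rw [Finset.mem_inter, not_and_or] at hi
        exact hi.elim (hz i) (hz' i)
      · rw [← h1]
        exact Finset.sum_subset Finset.inter_subset_left hz2
      · rw [← hx]
        exact Finset.sum_subset Finset.inter_subset_left fun i hi hi' => by rw [hz2 i hi hi', zero_smul]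
    · rintro ⟨c, h0, hz, h1, hx⟩
      have hz2 : ∀ i, i ∉ s ∩ t → c i = 0 := hz
      refine ⟨⟨c, h0, fun i hi => hz i fun h' => hi (Finset.mem_inter.1 h').1, ?_, ?_⟩,
        ⟨c, h0, fun i hi => hz i fun h' => hi (Finset.mem_inter.1 h').2, ?_, ?_⟩⟩
      · rw [← h1]
        exact (Finset.sum_subset Finset.inter_subset_left fun i _ hi => hz i hi).symm
      · rw [← hx]
        exact (Finset.sum_subset Finset.inter_subset_left fun i _ hi => by
          rw [hz i hi, zero_smul]).symm
      · rw [← h1]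
        exact (Finset.sum_subset Finset.inter_subset_right fun i _ hi => hz i hi).symm
      · rw [← hx]
        exact (Finset.sum_subset Finset.inter_subset_right fun i _ hi => by
          rw [hz i hi, zero_smul]).symm

/-! ### The two small spheres -/

def tetra0 : Finset (Finset ℕ) := {{0, 1, 2}, {0, 1, 3}, {0, 2, 3}, {1, 2, 3}}

def bip0 : Finset (Finset ℕ) :=
  {{0, 1, 3}, {0, 2, 3}, {1, 2, 3}, {0, 1, 4}, {0, 2, 4}, {1, 2, 4}}

theorem sum_eq_range5 {M : Type*} [AddCommMonoid M] {s : Finset ℕ} (hs : s ⊆ range 5)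
    (g : ℕ → M) (hg : ∀ i, i ∉ s → g i = 0) :
    ∑ i ∈ s, g i = g 0 + g 1 + g 2 + g 3 + g 4 := by
  rw [Finset.sum_subset hs fun i _ hi => hg i hi]
  simp [Finset.sum_range_succ]

/-- The vertices of the standard tetrahedron, and the barycentre of one of its triangles. -/
def vtx (i : ℕ) : ℕ → ℝ :=
  if i = 4 then fun j => if j < 3 then 1 / 3 else 0 else fun j => if j = i then 1 else 0

/-- Barycentric coordinates in the subdivided boundary. -/
def wt (x : ℕ → ℝ) (i : ℕ) : ℝ :=
  if i = 4 then 3 * min (x 0) (min (x 1) (x 2))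
  else if i < 3 then x i - min (x 0) (min (x 1) (x 2)) else x i

theorem comb_apply {s : Finset ℕ} (hs : s ⊆ range 5) (c : ℕ → ℝ) (hc : ∀ i, i ∉ s → c i = 0)
    (j : ℕ) : (∑ i ∈ s, c i • vtx i) j =
      if j < 3 then c j + c 4 / 3 else if j = 3 then c 3 else 0 := by
  rw [sum_eq_range5 hs _ (fun i hi => by rw [hc i hi, zero_smul])]
  simp only [Pi.add_apply, Pi.smul_apply, smul_eq_mul, vtx]
  by_cases h0 : j = 0
  · subst h0; norm_num; ring
  by_cases h1 : j = 1
  · subst h1; norm_num; ring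
  by_cases h2 : j = 2
  · subst h2; norm_num; ring
  by_cases h3 : j = 3
  · subst h3; norm_num
  have : ¬ j < 3 := by omega
  simp [h0, h1, h2, h3, this]

theorem bary_sub (K : Finset (Finset ℕ)) (hK : ∀ s ∈ K, s ⊆ range 5 ∧ (0 ∉ s ∨ 1 ∉ s ∨ 2 ∉ s)) :
    Bary K vtx wt := by
  intro s hs c h0 hz _
  obtain ⟨h5, hm⟩ := hK s hs
  have hx := comb_apply h5 c hz
  have hmin : min (c 0 + c 4 / 3) (min (c 1 + c 4 / 3) (c 2 + c 4 / 3)) = c 4 / 3 := by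
    have a0 := h0 0
    have a1 := h0 1
    have a2 := h0 2
    apply le_antisymm
    · rcases hm with h | h | h
      · exact (min_le_left _ _).trans (by rw [hz _ h]; simp)
      · exact (min_le_right _ _).trans ((min_le_left _ _).trans (by rw [hz _ h]; simp))
      · exact (min_le_right _ _).trans ((min_le_right _ _).trans (by rw [hz _ h]; simp))
    · refine le_min ?_ (le_min ?_ ?_) <;> linarith
  funext i
  have e : wt (∑ i ∈ s, c i • vtx i) i = if i = 4 then 3 * (c 4 / 3)
      else if i < 3 then (∑ i ∈ s, c i • vtx i) i - c 4 / 3 else (∑ i ∈ s, c i • vtx i) i := by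
    rw [wt, hx 0, hx 1, hx 2]
    norm_num only [if_true]
    rw [hmin]
  rw [e, hx i]
  by_cases h4 : i = 4
  · subst h4; simp; ring
  by_cases h3 : i < 3
  · simp [h4, h3]
  by_cases h3' : i = 3
  · subst h3'; simp
  · have : i ∉ s := fun h => by
      have := Finset.mem_range.1 (h5 h)
      omega
    simp [h4, h3, h3', hz i this]

theorem bary_tetra (K : Finset (Finset ℕ)) (hK : ∀ s ∈ K, s ⊆ range 4) :
    Bary K vtx (fun x => x) := by
  intro s hs c h0 hz _
  have h4 := hK s hs
  have hx := comb_apply (h4.trans (by decide)) c hz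
  have hc4 : c 4 = 0 := hz 4 fun h => by simpa using h4 h
  funext i
  refine (hx i).trans ?_
  by_cases h3 : i < 3
  · simp [h3, hc4]
  by_cases h3' : i = 3
  · subst h3'; simp
  · have : i ∉ s := fun h => by
      have := Finset.mem_range.1 (h4 h)
      omega
    simp [h3, h3', hz i this]

def gTetra : GComplex :=
  mkG (gen tetra0) (isComplex_gen ⟨{0, 1, 2}, by decide, by decide⟩) vtx (fun x => x)
    (bary_tetra _ (by decide +kernel))

def gBip : GComplex :=
  mkG (gen bip0) (isComplex_gen ⟨{0, 1, 3}, by decide, by decide⟩) vtx wt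
    (bary_sub _ (by decide +kernel))

theorem realizes_gTetra : Realizes gTetra (gen tetra0) :=
  ⟨vtx, Bary.injOn (isComplex_gen ⟨{0, 1, 2}, by decide, by decide⟩)
    (bary_tetra _ (by decide +kernel)), rfl⟩

theorem realizes_gBip : Realizes gBip (gen bip0) :=
  ⟨vtx, Bary.injOn (isComplex_gen ⟨{0, 1, 3}, by decide, by decide⟩)
    (bary_sub _ (by decide +kernel)), rfl⟩

theorem subdivides_refl (G : GComplex) : Subdivides G G :=
  ⟨rfl, fun s hs => ⟨s, hs, subset_rfl⟩⟩

theorem iso_refl (K : Finset (Finset V)) : Iso K K :=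
  ⟨id, Set.injOn_id _, by ext s; simp⟩

theorem vtx_injOn : Set.InjOn vtx ↑(range 5) := by
  have h := Bary.injOn (isComplex_gen ⟨{0, 1, 3}, by decide, by decide⟩)
    (bary_sub (gen bip0) (by decide +kernel))
  have : verts (gen bip0) = range 5 := by decide +kernel
  rwa [this] at h

theorem hull_face_mono {s t : Finset ℕ} (h : s ⊆ t) :
    convexHull ℝ ((s.image vtx : Finset (ℕ → ℝ)) : Set (ℕ → ℝ)) ⊆
      convexHull ℝ ((t.image vtx : Finset (ℕ → ℝ)) : Set (ℕ → ℝ)) :=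
  convexHull_mono (Finset.coe_subset.2 (Finset.image_subset_image h))

theorem sub_faces : ∀ s ∈ gBip.faces, ∃ t ∈ gTetra.faces,
    convexHull ℝ (s : Set (ℕ → ℝ)) ⊆ convexHull ℝ (t : Set (ℕ → ℝ)) := by
  intro s' hs'
  obtain ⟨s, hs, rfl⟩ := Finset.mem_image.1 (show s' ∈ (gen bip0).image (Finset.image vtx) from hs')
  have key : ∀ s ∈ gen bip0, s ∈ gen tetra0 ∨ s ⊆ {0, 1, 2, 4} := by decide +kernel
  rcases key s hs with h | h
  · exact ⟨_, Finset.mem_image_of_mem _ h, subset_rfl⟩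
  · refine ⟨_, Finset.mem_image_of_mem _ (show {0, 1, 2} ∈ gen tetra0 by decide +kernel), ?_⟩
    refine (hull_face_mono h).trans (convexHull_min ?_ (convex_convexHull ℝ _))
    intro x hx
    obtain ⟨i, hi, rfl⟩ := Finset.mem_image.1 (Finset.mem_coe.1 hx)
    simp only [Finset.mem_insert, Finset.mem_singleton] at hi
    by_cases h4 : i = 4
    · subst h4
      rw [mem_hull (vtx_injOn.mono (by
        rw [Finset.coe_subset]; decide))]
      refine ⟨fun i => if i ∈ ({0, 1, 2} : Finset ℕ) then 1 / 3 else 0, ?_, ?_, ?_, ?_⟩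
      · intro i
        dsimp only
        split_ifs <;> norm_num
      · intro i hi
        simp only [hi, if_false]
      · norm_num
      · funext j
        rw [comb_apply (by decide) _ (fun i hi => by simp only [hi, if_false])]
        have h4 : (4 : ℕ) ∉ ({0, 1, 2} : Finset ℕ) := by decide
        have hj : j ∈ ({0, 1, 2} : Finset ℕ) ↔ j < 3 := by
          simp only [Finset.mem_insert, Finset.mem_singleton]; omega
        by_cases h3 : j < 3
        · simp [vtx, h3]; omega
        · by_cases h3' : j = 3 <;> simp [vtx, h3, h3']
    · apply subset_convexHull
      apply Finset.mem_coe.2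
      apply Finset.mem_image_of_mem
      simp only [Finset.mem_insert, Finset.mem_singleton]
      omega

theorem carrier_eq : gBip.carrier = gTetra.carrier := by
  apply Set.Subset.antisymm
  · intro x hx
    simp only [GComplex.carrier, Set.mem_iUnion] at hx ⊢
    obtain ⟨s, hs, hx⟩ := hx
    obtain ⟨t, ht, hst⟩ := sub_faces s hs
    exact ⟨t, ht, hst hx⟩
  · intro x hx
    simp only [GComplex.carrier, Set.mem_iUnion] at hx ⊢
    obtain ⟨s', hs', hx⟩ := hx
    obtain ⟨s, hs, rfl⟩ := Finset.mem_image.1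
      (show s' ∈ (gen tetra0).image (Finset.image vtx) from hs')
    have key : ∀ s ∈ gen tetra0, s ∈ gen bip0 ∨ s = {0, 1, 2} := by decide +kernel
    rcases key s hs with h | rfl
    · exact ⟨_, Finset.mem_image_of_mem _ h, hx⟩
    · rw [mem_hull (vtx_injOn.mono (by rw [Finset.coe_subset]; decide))] at hx
      obtain ⟨c, h0, hz, h1, hx⟩ := hx
      have hc4 := hz 4 (by decide)
      have hc3 := hz 3 (by decide)
      have h1' : c 0 + c 1 + c 2 = 1 := by
        rw [← h1]
        simp [add_assoc]
      -- `k` is the position of the smallest coordinate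
      have main : ∀ t ∈ gen bip0, t ⊆ range 5 → ∀ d : ℕ → ℝ, (∀ i, 0 ≤ d i) → (∀ i, i ∉ t → d i = 0) →
          d 0 + d 1 + d 2 + d 3 + d 4 = 1 → c 0 = d 0 + d 4 / 3 → c 1 = d 1 + d 4 / 3 →
          c 2 = d 2 + d 4 / 3 → d 3 = 0 →
          ∃ i, ∃ (_ : i ∈ gBip.faces), x ∈ convexHull ℝ (i : Set (ℕ → ℝ)) := by
        intro t ht ht5 d hd0 hdz hd1 e0 e1 e2 e3
        refine ⟨_, Finset.mem_image_of_mem _ ht, ?_⟩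
        rw [mem_hull (vtx_injOn.mono (Finset.coe_subset.2 ht5))]
        refine ⟨d, hd0, hdz, by rw [sum_eq_range5 ht5 d hdz, hd1], ?_⟩
        rw [← hx]
        funext j
        rw [comb_apply ht5 d hdz, comb_apply (by decide) c hz, hc4, hc3, e3]
        by_cases h0 : j = 0
        · subst h0; simp [e0]
        by_cases h1 : j = 1
        · subst h1; simp [e1]
        by_cases h2 : j = 2
        · subst h2; simp [e2]
        have : ¬ j < 3 := by omega
        simp [this]
      have n0 := h0 0
      have n1 := h0 1
      have n2 := h0 2
      have fin : ∀ k < 3, c k ≤ c 0 → c k ≤ c 1 → c k ≤ c 2 →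
          ∃ i, ∃ (_ : i ∈ gBip.faces), x ∈ convexHull ℝ (i : Set (ℕ → ℝ)) := by
        intro k hk l0 l1 l2
        have ht : ∀ k < 3, ({0, 1, 2, 4} : Finset ℕ).erase k ∈ gen bip0 := by decide +kernel
        have nk := h0 k
        refine main _ (ht k hk) ((Finset.erase_subset _ _).trans (by decide))
          (fun i => if i = 4 then 3 * c k else if i < 3 then c i - c k else 0) ?_ ?_ ?_ ?_ ?_ ?_ ?_
        · intro i
          split_ifs with h4 h3
          · linarith
          · interval_cases i <;> linarith
          · exact le_rfl
        · intro i hi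
          simp only [Finset.mem_erase, Finset.mem_insert, Finset.mem_singleton] at hi
          by_cases hik : i = k
          · subst hik
            have : i ≠ 4 := by omega
            simp [this]
          · have : i ≠ 4 ∧ ¬ i < 3 := by omega
            simp [this.1, this.2]
        all_goals norm_num
        all_goals linarith
      rcases le_total (c 0) (c 1) with h | h <;> rcases le_total (c 1) (c 2) with h' | h' <;>
        rcases le_total (c 0) (c 2) with h'' | h''
      all_goals first
        | exact fin 0 (by norm_num) (by linarith) (by linarith) (by linarith)
        | exact fin 1 (by norm_num) (by linarith) (by linarith) (by linarith)
        | exact fin 2 (by norm_num) (by linarith) (by linarith) (by linarith)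

theorem stdSphere_tetra0 : gen tetra0 = stdSphere ({0, 1, 2, 3} : Finset ℕ) := by decide +kernel

theorem combSphere_tetra : IsCombSphere 2 (gen tetra0) :=
  ⟨{0, 1, 2, 3}, by decide, gTetra, gTetra, gTetra, gTetra, realizes_gTetra,
    stdSphere_tetra0 ▸ realizes_gTetra, subdivides_refl _, subdivides_refl _, iso_refl _⟩

theorem combSphere_bip : IsCombSphere 2 (gen bip0) :=
  ⟨{0, 1, 2, 3}, by decide, gBip, gBip, gTetra, gBip, realizes_gBip,
    stdSphere_tetra0 ▸ realizes_gTetra, subdivides_refl _, ⟨carrier_eq, sub_faces⟩, iso_refl _⟩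

/-! ### The models -/

/-- A family of triangles which is a copy of one of the two small spheres. -/
def IsSph (F : Finset (Finset V)) : Prop :=
  ∃ f : V → ℕ, Set.InjOn f ↑(verts (gen F)) ∧
    (F.image (Finset.image f) = tetra0 ∨ F.image (Finset.image f) = bip0)

theorem IsSph.combSphere {F : Finset (Finset V)} (h : IsSph F) :
    IsComplex (gen F) ∧ IsCombSphere 2 (gen F) ∧
      ((verts (gen F)).card = 4 ∨ (verts (gen F)).card = 5) := by
  obtain ⟨f, hf, h | h⟩ := h
  · have hi := iso_gen F f hf _ h
    refine ⟨isComplex_gen ?_, combSphere_of_iso hi combSphere_tetra, Or.inl ?_⟩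
    · obtain ⟨t, ht, he⟩ := Finset.mem_image.1 (h ▸ (by decide : ({0, 1, 2} : Finset ℕ) ∈ tetra0))
      refine ⟨t, ht, ?_⟩
      rintro rfl
      rw [Finset.image_empty] at he; exact absurd he (by decide)
    · rw [hi.verts_card]
      decide +kernel
  · have hi := iso_gen F f hf _ h
    refine ⟨isComplex_gen ?_, combSphere_of_iso hi combSphere_bip, Or.inr ?_⟩
    · obtain ⟨t, ht, he⟩ := Finset.mem_image.1 (h ▸ (by decide : ({0, 1, 3} : Finset ℕ) ∈ bip0))
      refine ⟨t, ht, ?_⟩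
      rintro rfl
      rw [Finset.image_empty] at he; exact absurd he (by decide)
    · rw [hi.verts_card]
      decide +kernel

theorem isSph_of_list (F : Finset (Finset ℕ)) (l : List ℕ)
    (h1 : ∀ a ∈ verts (gen F), ∀ b ∈ verts (gen F), l.getD a 0 = l.getD b 0 → a = b)
    (h2 : F.image (Finset.image fun v => l.getD v 0) = tetra0 ∨
      F.image (Finset.image fun v => l.getD v 0) = bip0) : IsSph F :=
  ⟨fun v => l.getD v 0, fun a ha b hb hab => h1 a ha b hb hab, h2⟩

def UnionSph (F : Finset (Finset V)) : Prop :=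
  ∃ F₁ F₂ : Finset (Finset V), F = F₁ ∪ F₂ ∧ (∀ t ∈ F₁, t ∉ F₂) ∧ IsSph F₁ ∧ IsSph F₂

theorem models_card : ∀ p ∈ modelTab, (modelF p.1).card = p.2 := by decide +kernel

theorem union_model0 :
    UnionSph (modelF 0x60000222400000600000042440000000000060a0c0000000006001214000022420a120078000024440c147800000000000000000000) :=
  ⟨powersetCard 3 {1, 2, 3, 4},
    powersetCard 3 {1, 2, 5, 6},
    by decide +kernel, by decide +kernel,
    isSph_of_list _ [0, 0, 1, 2, 3, 0, 0, 0] (by decide +kernel) (Or.inl (by decide +kernel)),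
    isSph_of_list _ [0, 0, 1, 0, 0, 2, 3, 0] (by decide +kernel) (Or.inl (by decide +kernel))⟩

theorem union_model1 :
    UnionSph (modelF 0x22420000006000220082000000a000428200000000c00000000000060a0c0000000006001214000000000a1200180060a0c00c141800000000000000000000) :=
  ⟨powersetCard 3 {1, 2, 3, 4},
    powersetCard 3 {1, 5, 6, 7},
    by decide +kernel, by decide +kernel,
    isSph_of_list _ [0, 0, 1, 2, 3, 0, 0, 0] (by decide +kernel) (Or.inl (by decide +kernel)),
    isSph_of_list _ [0, 0, 0, 0, 0, 1, 2, 3] (by decide +kernel) (Or.inl (by decide +kernel))⟩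

theorem union_model2 :
    UnionSph (modelF 0x60a0c0000000000060a0c0000000000060a0c000006060600727400000a0a0a72007800000c0c0c747800000000000000000000) :=
  ⟨powersetCard 3 {1, 2, 3, 4},
    {{1, 2, 5}, {1, 3, 5}, {2, 3, 5}, {1, 2, 6}, {1, 3, 6}, {2, 3, 6}},
    by decide +kernel, by decide +kernel,
    isSph_of_list _ [0, 0, 1, 2, 3, 0, 0, 0] (by decide +kernel) (Or.inl (by decide +kernel)),
    isSph_of_list _ [0, 0, 1, 2, 0, 3, 4, 0] (by decide +kernel) (Or.inr (by decide +kernel))⟩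

theorem union_model3 :
    UnionSph (modelF 0x6000022240000000600002224000606000000c0c00000000000060a0c0000000006001214002222c00a1200d8002424c00c14d800000000000000000000) :=
  ⟨powersetCard 3 {1, 2, 3, 4},
    {{1, 2, 6}, {1, 5, 6}, {2, 5, 6}, {1, 2, 7}, {1, 5, 7}, {2, 5, 7}},
    by decide +kernel, by decide +kernel,
    isSph_of_list _ [0, 0, 1, 2, 3, 0, 0, 0] (by decide +kernel) (Or.inl (by decide +kernel)),
    isSph_of_list _ [0, 0, 1, 0, 0, 2, 3, 4] (by decide +kernel) (Or.inr (by decide +kernel))⟩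

theorem union_model4 :
    UnionSph (modelF 0xc0022220c00000c000042420c0000000000060a0c0000224206001274000022420a12007800000c0c0c747800000000000000000000) :=
  ⟨powersetCard 3 {1, 2, 3, 4},
    {{1, 2, 5}, {1, 2, 6}, {2, 5, 6}, {1, 3, 5}, {1, 3, 6}, {3, 5, 6}},
    by decide +kernel, by decide +kernel,
    isSph_of_list _ [0, 0, 1, 2, 3, 0, 0, 0] (by decide +kernel) (Or.inl (by decide +kernel)),
    isSph_of_list _ [0, 0, 3, 4, 0, 1, 2, 0] (by decide +kernel) (Or.inr (by decide +kernel))⟩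

theorem union_model5 :
    UnionSph (modelF 0x224200000060002200840000228400428400000042840000000000060a0c0000000006001214000022420a120078006084840c147800000000000000000000) :=
  ⟨powersetCard 3 {1, 2, 3, 4},
    {{1, 2, 5}, {1, 2, 6}, {2, 5, 6}, {1, 5, 7}, {1, 6, 7}, {5, 6, 7}},
    by decide +kernel, by decide +kernel,
    isSph_of_list _ [0, 0, 1, 2, 3, 0, 0, 0] (by decide +kernel) (Or.inl (by decide +kernel)),
    isSph_of_list _ [0, 0, 3, 0, 0, 1, 2, 4] (by decide +kernel) (Or.inr (by decide +kernel))⟩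

theorem union_model6 :
    UnionSph (modelF 0x60600006060000600060000a0a0000606000000c0c00000000000060a0c00000000060012140060a0c00a1200180060a0c00c141800000000000000000000) :=
  ⟨powersetCard 3 {1, 2, 3, 4},
    {{1, 5, 6}, {1, 5, 7}, {1, 6, 7}, {2, 5, 6}, {2, 5, 7}, {2, 6, 7}},
    by decide +kernel, by decide +kernel,
    isSph_of_list _ [0, 0, 1, 2, 3, 0, 0, 0] (by decide +kernel) (Or.inl (by decide +kernel)),
    isSph_of_list _ [0, 3, 4, 0, 0, 0, 1, 2] (by decide +kernel) (Or.inr (by decide +kernel))⟩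

theorem models {m n : ℕ} (h : (m, n) ∈ modelTab) :
    UnionSph (modelF m) ∨
    gen (modelF m) = S24 ∨ gen (modelF m) = S13S02 ∨ gen (modelF m) = Octa ∨
      gen (modelF m) = S15S02 ∨ gen (modelF m) = RP26 ∨ gen (modelF m) = Sigma1 ∨
      gen (modelF m) = Sigma2 ∨ gen (modelF m) = Sigma3 ∨ gen (modelF m) = Sigma4 ∨
      gen (modelF m) = Sigma5 ∨ gen (modelF m) = Rcomplex := by
  simp only [modelTab, List.mem_cons, List.not_mem_nil, or_false, Prod.mk.injEq] at h
  rcases h with ⟨rfl, -⟩ | ⟨rfl, -⟩ | ⟨rfl, -⟩ | ⟨rfl, -⟩ | ⟨rfl, -⟩ | ⟨rfl, -⟩ | ⟨rfl, -⟩ | ⟨rfl, -⟩ | ⟨rfl, -⟩ | ⟨rfl, -⟩ | ⟨rfl, -⟩ | ⟨rfl, -⟩ | ⟨rfl, -⟩ | ⟨rfl, -⟩ | ⟨rfl, -⟩ | ⟨rfl, -⟩ | ⟨rfl, -⟩ | ⟨rfl, -⟩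
  · exact Or.inr (Or.inl (by decide +kernel))
  · exact Or.inr (Or.inr (Or.inl (by decide +kernel)))
  · exact Or.inr (Or.inr (Or.inr (Or.inl (by decide +kernel))))
  · exact Or.inr (Or.inr (Or.inr (Or.inr (Or.inl (by decide +kernel)))))
  · exact Or.inr (Or.inr (Or.inr (Or.inr (Or.inr (Or.inl (by decide +kernel))))))
  · exact Or.inr (Or.inr (Or.inr (Or.inr (Or.inr (Or.inr (Or.inl (by decide +kernel)))))))
  · exact Or.inr (Or.inr (Or.inr (Or.inr (Or.inr (Or.inr (Or.inr (Or.inl (by decide +kernel))))))))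
  · exact Or.inr (Or.inr (Or.inr (Or.inr (Or.inr (Or.inr (Or.inr (Or.inr (Or.inl (by decide +kernel)))))))))
  · exact Or.inr (Or.inr (Or.inr (Or.inr (Or.inr (Or.inr (Or.inr (Or.inr (Or.inr (Or.inl (by decide +kernel))))))))))
  · exact Or.inr (Or.inr (Or.inr (Or.inr (Or.inr (Or.inr (Or.inr (Or.inr (Or.inr (Or.inr (Or.inl (by decide +kernel)))))))))))
  · exact Or.inr (Or.inr (Or.inr (Or.inr (Or.inr (Or.inr (Or.inr (Or.inr (Or.inr (Or.inr (Or.inr ((by decide +kernel))))))))))))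
  · exact Or.inl union_model0
  · exact Or.inl union_model1
  · exact Or.inl union_model2
  · exact Or.inl union_model3
  · exact Or.inl union_model4
  · exact Or.inl union_model5
  · exact Or.inl union_model6

/-! ### Transport along vertex maps -/

theorem image_sub_iff {f : V → W} {S : Finset V} (hf : Set.InjOn f ↑S) {s t : Finset V}
    (hs : s ⊆ S) (ht : t ⊆ S) : s.image f ⊆ t.image f ↔ s ⊆ t := by
  constructor
  · intro h v hv
    obtain ⟨w, hw, he⟩ := Finset.mem_image.1 (h (Finset.mem_image_of_mem f hv))
    rwa [← hf (ht hw) (hs hv) he]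
  · exact fun h => Finset.image_subset_image h

theorem image_inj {f : V → W} {S : Finset V} (hf : Set.InjOn f ↑S) {s t : Finset V}
    (hs : s ⊆ S) (ht : t ⊆ S) (h : s.image f = t.image f) : s = t :=
  Finset.Subset.antisymm ((image_sub_iff hf hs ht).1 h.le) ((image_sub_iff hf ht hs).1 h.ge)

theorem tri_subset_verts {T : Finset (Finset V)} {t : Finset V} (ht : t ∈ T) :
    t ⊆ verts (gen T) := fun _ hv => mem_verts_gen.2 ⟨t, ht, hv⟩

theorem verts_gen_mono {T T' : Finset (Finset V)} (h : T ⊆ T') :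
    verts (gen T) ⊆ verts (gen T') := by
  intro v hv
  obtain ⟨s, hs, hvs⟩ := mem_verts_gen.1 hv
  exact mem_verts_gen.2 ⟨s, h hs, hvs⟩

theorem image_card {T : Finset (Finset V)} {f : V → W}
    (hf : Set.InjOn f ↑(verts (gen T))) : (T.image (Finset.image f)).card = T.card :=
  Finset.card_image_of_injOn fun _ hs _ ht h =>
    image_inj hf (tri_subset_verts hs) (tri_subset_verts ht) h

theorem IsSph.pullback {T : Finset (Finset V)} {f : V → W} (hf : Set.InjOn f ↑(verts (gen T)))
    {F : Finset (Finset W)} (h : T.image (Finset.image f) = F) (hF : IsSph F) : IsSph T := by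
  obtain ⟨g, hg, h'⟩ := hF
  refine ⟨g ∘ f, hg.comp hf ?_, ?_⟩
  · intro v hv
    obtain ⟨s, hs, hvs⟩ := mem_verts_gen.1 hv
    refine mem_verts_gen.2 ⟨s.image f, ?_, Finset.mem_image_of_mem f hvs⟩
    rw [← h]
    exact Finset.mem_image_of_mem _ hs
  · have e : T.image (Finset.image (g ∘ f)) = F.image (Finset.image g) := by
      rw [← h, Finset.image_image]
      congr 1
      funext s
      simp [Finset.image_image]
    rwa [e]

theorem gen_union (F G : Finset (Finset V)) : gen (F ∪ G) = gen F ∪ gen G := by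
  ext s
  simp only [Finset.mem_union, mem_gen]
  constructor
  · rintro ⟨h, t, ht | ht, hst⟩
    · exact Or.inl ⟨h, t, ht, hst⟩
    · exact Or.inr ⟨h, t, ht, hst⟩
  · rintro (⟨h, t, ht, hst⟩ | ⟨h, t, ht, hst⟩)
    · exact ⟨h, t, Or.inl ht, hst⟩
    · exact ⟨h, t, Or.inr ht, hst⟩

theorem final_of_model {T : Finset (Finset V)} (hT3 : ∀ t ∈ T, t.card = 3) (f : V → ℕ)
    (hf : Set.InjOn f ↑(verts (gen T))) {m n : ℕ} (hmn : (m, n) ∈ modelTab) (hc : T.card = n)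
    (hmem : ∀ t ∈ T, t.image f ∈ modelF m) :
    (∃ K₁ K₂ : Finset (Finset V), IsComplex K₁ ∧ IsComplex K₂ ∧
      IsCombSphere 2 K₁ ∧ IsCombSphere 2 K₂ ∧
      ((verts K₁).card = 4 ∨ (verts K₁).card = 5) ∧
      ((verts K₂).card = 4 ∨ (verts K₂).card = 5) ∧
      gen T = K₁ ∪ K₂ ∧ ∀ s ∈ K₁, s ∈ K₂ → s.card ≠ 3) ∨
    Iso (gen T) S24 ∨ Iso (gen T) S13S02 ∨ Iso (gen T) Octa ∨ Iso (gen T) S15S02 ∨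
      Iso (gen T) RP26 ∨ Iso (gen T) Sigma1 ∨ Iso (gen T) Sigma2 ∨ Iso (gen T) Sigma3 ∨
      Iso (gen T) Sigma4 ∨ Iso (gen T) Sigma5 ∨ Iso (gen T) Rcomplex := by
  have him : T.image (Finset.image f) = modelF m := by
    apply Finset.eq_of_subset_of_card_le
    · intro s hs
      obtain ⟨t, ht, rfl⟩ := Finset.mem_image.1 hs
      exact hmem t ht
    · rw [image_card hf, hc]
      exact (models_card (m, n) hmn).le
  have hiso := iso_gen T f hf _ him
  rcases models hmn with h | h | h | h | h | h | h | h | h | h | h | h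
  · left
    obtain ⟨F₁, F₂, hF, hdis, h1, h2⟩ := h
    have sub : ∀ F : Finset (Finset ℕ), F ⊆ modelF m →
        (T.filter fun t => t.image f ∈ F).image (Finset.image f) = F := by
      intro F hFm
      ext s
      rw [Finset.mem_image]
      constructor
      · rintro ⟨t, ht, rfl⟩
        exact (Finset.mem_filter.1 ht).2
      · intro hs
        obtain ⟨t, ht, rfl⟩ := Finset.mem_image.1 (him ▸ hFm hs)
        exact ⟨t, Finset.mem_filter.2 ⟨ht, hs⟩, rfl⟩
    have inj : ∀ F : Finset (Finset ℕ),
        Set.InjOn f ↑(verts (gen (T.filter fun t => t.image f ∈ F))) := fun F =>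
      hf.mono (Finset.coe_subset.2 (verts_gen_mono (Finset.filter_subset _ _)))
    have k1 := (IsSph.pullback (inj F₁)
      (sub F₁ (by rw [hF]; exact Finset.subset_union_left)) h1).combSphere
    have k2 := (IsSph.pullback (inj F₂)
      (sub F₂ (by rw [hF]; exact Finset.subset_union_right)) h2).combSphere
    refine ⟨_, _, k1.1, k2.1, k1.2.1, k2.2.1, k1.2.2, k2.2.2, ?_, ?_⟩
    · rw [← gen_union, ← Finset.filter_or]
      congr 1
      symm
      rw [Finset.filter_eq_self]
      intro t ht
      have := hmem t ht
      rw [hF] at this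
      exact Finset.mem_union.1 this
    · intro s hs1 hs2 hs3
      obtain ⟨_, t1, ht1, hst1⟩ := mem_gen.1 hs1
      obtain ⟨_, t2, ht2, hst2⟩ := mem_gen.1 hs2
      rw [Finset.mem_filter] at ht1 ht2
      have e1 := Finset.eq_of_subset_of_card_le hst1 (by rw [hT3 _ ht1.1, hs3])
      have e2 := Finset.eq_of_subset_of_card_le hst2 (by rw [hT3 _ ht2.1, hs3])
      rw [← e1] at ht1
      rw [← e2] at ht2
      exact hdis _ ht1.2 ht2.2
  · rw [h] at hiso
    exact Or.inr (Or.inl hiso)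
  · rw [h] at hiso
    exact Or.inr (Or.inr (Or.inl hiso))
  · rw [h] at hiso
    exact Or.inr (Or.inr (Or.inr (Or.inl hiso)))
  · rw [h] at hiso
    exact Or.inr (Or.inr (Or.inr (Or.inr (Or.inl hiso))))
  · rw [h] at hiso
    exact Or.inr (Or.inr (Or.inr (Or.inr (Or.inr (Or.inl hiso)))))
  · rw [h] at hiso
    exact Or.inr (Or.inr (Or.inr (Or.inr (Or.inr (Or.inr (Or.inl hiso))))))
  · rw [h] at hiso
    exact Or.inr (Or.inr (Or.inr (Or.inr (Or.inr (Or.inr (Or.inr (Or.inl hiso)))))))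
  · rw [h] at hiso
    exact Or.inr (Or.inr (Or.inr (Or.inr (Or.inr (Or.inr (Or.inr (Or.inr (Or.inl hiso))))))))
  · rw [h] at hiso
    exact Or.inr (Or.inr (Or.inr (Or.inr (Or.inr (Or.inr (Or.inr (Or.inr (Or.inr (Or.inl hiso)))))))))
  · rw [h] at hiso
    exact Or.inr (Or.inr (Or.inr (Or.inr (Or.inr (Or.inr (Or.inr (Or.inr (Or.inr (Or.inr (Or.inl hiso))))))))))
  · rw [h] at hiso
    exact Or.inr (Or.inr (Or.inr (Or.inr (Or.inr (Or.inr (Or.inr (Or.inr (Or.inr (Or.inr (Or.inr (hiso)))))))))))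


/-! ### Links of vertices of small degree and reduction to labelled complexes -/

theorem pair_ext {x y z w : V} {v : V} (hx : x ≠ v) (hy : y ≠ v)
    (h : ({v, x, y} : Finset V) = {v, z, w}) : (x = z ∨ x = w) ∧ (y = z ∨ y = w) := by
  have h1 : x ∈ ({v, z, w} : Finset V) := h ▸ (by simp)
  have h2 : y ∈ ({v, z, w} : Finset V) := h ▸ (by simp)
  simp only [Finset.mem_insert, Finset.mem_singleton] at h1 h2
  exact ⟨h1.resolve_left hx, h2.resolve_left hy⟩

theorem third_vertex {t : Finset V} (h3 : t.card = 3) {v b : V} (hvb : v ≠ b)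
    (hs : {v, b} ⊆ t) : ∃ c, c ≠ v ∧ c ≠ b ∧ t = {v, b, c} := by
  have h1 : (t \ {v, b}).card = 1 := by
    rw [Finset.card_sdiff_of_subset hs, h3, Finset.card_pair hvb]
  obtain ⟨c, hc⟩ := Finset.card_eq_one.1 h1
  have hm : c ∈ t \ {v, b} := hc ▸ Finset.mem_singleton_self c
  simp only [Finset.mem_sdiff, Finset.mem_insert, Finset.mem_singleton, not_or] at hm
  refine ⟨c, hm.2.1, hm.2.2, ?_⟩
  rw [← Finset.union_sdiff_of_subset hs, hc]
  ext x
  simp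

/-- `x` and `y` are adjacent in the link of `v`. -/
def LAdj (T : Finset (Finset V)) (v x y : V) : Prop :=
  x ≠ v ∧ y ≠ v ∧ x ≠ y ∧ {v, x, y} ∈ T

theorem LAdj.symm {T : Finset (Finset V)} {v x y : V} (h : LAdj T v x y) : LAdj T v y x := by
  obtain ⟨h1, h2, h3, h4⟩ := h
  refine ⟨h2, h1, h3.symm, ?_⟩
  rwa [Finset.pair_comm]

theorem LAdj.another {T : Finset (Finset V)} (hT3 : ∀ t ∈ T, t.card = 3)
    (heven : ∀ s : Finset V, s.card = 2 → Even (T.filter fun t => s ⊆ t).card)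
    {v a b : V} (h : LAdj T v a b) : ∃ c, c ≠ a ∧ LAdj T v b c := by
  obtain ⟨ha, hb, hab, hm⟩ := h
  have he := heven {v, b} (Finset.card_pair hb.symm)
  have hmem : ({v, a, b} : Finset V) ∈ T.filter fun t => {v, b} ⊆ t := by
    rw [Finset.mem_filter]
    refine ⟨hm, ?_⟩
    intro x
    simp only [Finset.mem_insert, Finset.mem_singleton]
    tauto
  have hpos := Finset.card_pos.2 ⟨_, hmem⟩
  have h2 : 1 < (T.filter fun t => {v, b} ⊆ t).card := by
    obtain ⟨k, hk⟩ := he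
    omega
  obtain ⟨t, ht, hne⟩ := Finset.exists_mem_ne h2 {v, a, b}
  rw [Finset.mem_filter] at ht
  obtain ⟨c, hcv, hcb, rfl⟩ := third_vertex (hT3 t ht.1) hb.symm ht.2
  refine ⟨c, ?_, hb, hcv, hcb.symm, ht.1⟩
  rintro rfl
  exact hne (by rw [Finset.pair_comm])

theorem LAdj.exists_of_mem {T : Finset (Finset V)} (hT3 : ∀ t ∈ T, t.card = 3)
    {v : V} {t : Finset V} (ht : t ∈ T) (hv : v ∈ t) : ∃ x y, LAdj T v x y ∧ t = {v, x, y} := by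
  have h1 : (t.erase v).card = 2 := by rw [Finset.card_erase_of_mem hv, hT3 t ht]
  obtain ⟨x, y, hxy, h⟩ := Finset.card_eq_two.1 h1
  have hte : t = {v, x, y} := by rw [← Finset.insert_erase hv, h]
  have hx : x ∈ t.erase v := by rw [h]; simp
  have hy : y ∈ t.erase v := by rw [h]; simp
  exact ⟨x, y, ⟨Finset.ne_of_mem_erase hx, Finset.ne_of_mem_erase hy, hxy, hte ▸ ht⟩, hte⟩

theorem small_link (T : Finset (Finset V)) (hT3 : ∀ t ∈ T, t.card = 3)
    (heven : ∀ s : Finset V, s.card = 2 → Even (T.filter fun t => s ⊆ t).card)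
    (v : V) (hv : ∃ t ∈ T, v ∈ t) (h4 : (T.filter fun t => v ∈ t).card ≤ 4) :
    (∃ a b c, LAdj T v a b ∧ LAdj T v b c ∧ LAdj T v a c ∧
      (T.filter fun t => v ∈ t) = {{v, a, b}, {v, b, c}, {v, a, c}}) ∨
    (∃ a b c d, LAdj T v a b ∧ LAdj T v b c ∧ LAdj T v c d ∧ LAdj T v a d ∧ a ≠ c ∧ b ≠ d ∧
      (T.filter fun t => v ∈ t) = {{v, a, b}, {v, b, c}, {v, c, d}, {v, a, d}}) := by
  have memL : ∀ {x y}, LAdj T v x y → {v, x, y} ∈ T.filter fun t => v ∈ t := by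
    intro x y h
    rw [Finset.mem_filter]
    exact ⟨h.2.2.2, by simp⟩
  -- a family of four different triangles of the link is the whole link
  have four : ∀ {p q r s : Finset V}, p ∈ (T.filter fun t => v ∈ t) →
      q ∈ (T.filter fun t => v ∈ t) → r ∈ (T.filter fun t => v ∈ t) →
      s ∈ (T.filter fun t => v ∈ t) → p ≠ q → p ≠ r → p ≠ s → q ≠ r → q ≠ s → r ≠ s →
      (T.filter fun t => v ∈ t) = {p, q, r, s} := by
    intro p q r s hp hq hr hs h1 h2 h3 h4' h5 h6
    symm
    apply Finset.eq_of_subset_of_card_le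
    · intro x hx
      simp only [Finset.mem_insert, Finset.mem_singleton] at hx
      rcases hx with rfl | rfl | rfl | rfl <;> assumption
    · refine h4.trans (le_of_eq ?_)
      symm
      rw [Finset.card_eq_of_equiv_fin]
      exact Finset.equivFinOfCardEq (by
        rw [Finset.card_insert_of_notMem (by simp [h1, h2, h3]),
          Finset.card_insert_of_notMem (by simp [h4', h5]), Finset.card_pair h6])
  obtain ⟨t, ht, hvt⟩ := hv
  obtain ⟨a, b, hab, -⟩ := LAdj.exists_of_mem hT3 ht hvt
  obtain ⟨c, hca, hbc⟩ := hab.another hT3 heven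
  obtain ⟨d, hdb, hcd⟩ := hbc.another hT3 heven
  obtain ⟨av, bv, anb, -⟩ := id hab
  obtain ⟨-, cv, bnc, -⟩ := id hbc
  obtain ⟨-, dv, cnd, -⟩ := id hcd
  have n1 : ({v, a, b} : Finset V) ≠ {v, b, c} := by
    intro h
    have := (pair_ext av bv h).1
    tauto
  by_cases hda : d = a
  · left
    subst hda
    refine ⟨d, b, c, hab, hbc, hcd.symm, ?_⟩
    have n2 : ({v, d, b} : Finset V) ≠ {v, d, c} := by
      intro h
      have := (pair_ext av bv h).2
      tauto
    have n3 : ({v, b, c} : Finset V) ≠ {v, d, c} := by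
      intro h
      have := (pair_ext bv cv h).1
      tauto
    apply Finset.Subset.antisymm
    · have key : ∀ x y, LAdj T v x y → x = d ∨ x = b ∨ x = c := by
        intro x y hxy
        by_contra hx
        push Not at hx
        obtain ⟨xd, xb, xc⟩ := hx
        obtain ⟨z, hzy, hxz⟩ := hxy.symm.another hT3 heven
        have no : ∀ {p q w}, x ≠ p → x ≠ q → ({v, p, q} : Finset V) ≠ {v, x, w} := by
          intro p q w hp hq h
          have := (pair_ext hxy.1 (by
            rintro rfl
            have h' : x ∈ ({w, p, q} : Finset V) := h ▸ (by simp)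
            simp only [Finset.mem_insert, Finset.mem_singleton] at h'
            have := hxy.1
            tauto) h.symm).1
          tauto
        have e := four (memL hab) (memL hbc) (memL hcd.symm) (memL hxy) n1 n2 (no xd xb) n3
          (no xb xc) (no xd xc)
        have hz := memL hxz
        rw [e] at hz
        simp only [Finset.mem_insert, Finset.mem_singleton] at hz
        rcases hz with h | h | h | h
        · exact no xd xb h.symm
        · exact no xb xc h.symm
        · exact no xd xc h.symm
        · have h1 := (pair_ext hxz.1 hxz.2.1 h).2
          have := hxz.2.2.1
          rcases h1 with h1 | h1
          · exact this h1.symm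
          · exact hzy h1
      intro s hs
      rw [Finset.mem_filter] at hs
      obtain ⟨x, y, hxy, rfl⟩ := LAdj.exists_of_mem hT3 hs.1 hs.2
      have h1 := key x y hxy
      have h2 := key y x hxy.symm
      have h3 := hxy.2.2.1
      simp only [Finset.mem_insert, Finset.mem_singleton]
      rcases h1 with rfl | rfl | rfl <;> rcases h2 with rfl | rfl | rfl <;>
        first
          | exact absurd rfl h3
          | simp [Finset.pair_comm]
    · intro s hs
      simp only [Finset.mem_insert, Finset.mem_singleton] at hs
      rcases hs with rfl | rfl | rfl
      · exact memL hab
      · exact memL hbc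
      · exact memL hcd.symm
  · right
    obtain ⟨f, hfc, hdf⟩ := hcd.another hT3 heven
    obtain ⟨-, fv, dnf, -⟩ := id hdf
    have e := four (memL hab) (memL hbc) (memL hcd) (memL hdf) n1
      (by intro h; have := pair_ext av bv h; tauto)
      (by intro h; have := pair_ext dv fv h.symm; tauto)
      (by intro h; have := pair_ext bv cv h; tauto)
      (by intro h; have := pair_ext dv fv h.symm; tauto)
      (by intro h; have := pair_ext dv fv h.symm; tauto)
    obtain ⟨g, hgb, hag⟩ := hab.symm.another hT3 heven
    have hz := memL hag
    rw [e] at hz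
    simp only [Finset.mem_insert, Finset.mem_singleton] at hz
    have gv := hag.2.1
    have gna := hag.2.2.1
    have hfa : f = a := by
      rcases hz with h | h | h | h <;> have := pair_ext av gv h
      · exfalso; grind
      · exfalso; grind
      · exfalso; grind
      · grind
    subst hfa
    refine ⟨f, b, c, d, hab, hbc, hcd, hdf.symm, hca.symm, hdb.symm, ?_⟩
    rw [e, Finset.pair_comm d f]

theorem exists_labelling (S : Finset V) (t : Finset ℕ) (hc : S.card = t.card) (l : V → ℕ)
    (P : Finset V) (hP : P ⊆ S) (hm : ∀ x ∈ P, l x ∈ t) (hi : Set.InjOn l ↑P) :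
    ∃ e : V → ℕ, Set.InjOn e ↑S ∧ (∀ x ∈ S, e x ∈ t) ∧ ∀ x ∈ P, e x = l x := by
  obtain ⟨g, hg⟩ := Set.MapsTo.exists_equiv_extend_of_card_eq (α := {x // x ∈ S}) (t := t)
    (by rw [Fintype.card_coe, hc]) (s := {x | (x : V) ∈ P}) (f := fun x => l x)
    (fun x hx => hm x hx) (fun x hx y hy h => Subtype.ext (hi hx hy h))
  refine ⟨fun x => if h : x ∈ S then (g ⟨x, h⟩ : ℕ) else 0, ?_, ?_, ?_⟩
  · intro x hx y hy h
    have hx' : x ∈ S := hx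
    have hy' : y ∈ S := hy
    simp only [hx', hy', dif_pos] at h
    have := g.injective (Subtype.ext h)
    exact congrArg Subtype.val this
  · intro x hx
    simp only [hx, dif_pos]
    exact (g ⟨x, hx⟩).2
  · intro x hx
    simp only [hP hx, dif_pos]
    exact hg ⟨x, hP hx⟩ hx

theorem exists_low_degree (T : Finset (Finset V)) (hT3 : ∀ t ∈ T, t.card = 3)
    (h10 : T.card ≤ 10) (h7 : (verts (gen T)).card = 7) :
    ∃ v ∈ verts (gen T), (T.filter fun t => v ∈ t).card ≤ 4 := by
  by_contra hcon
  push Not at hcon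
  have h1 : ∑ v ∈ verts (gen T), (T.filter fun t => v ∈ t).card = ∑ t ∈ T, t.card := by
    have := Finset.sum_card_bipartiteAbove_eq_sum_card_bipartiteBelow
      (s := verts (gen T)) (t := T) (fun (v : V) (t : Finset V) => v ∈ t)
    simp only [Finset.bipartiteAbove, Finset.bipartiteBelow] at this
    rw [this]
    refine Finset.sum_congr rfl fun t ht => ?_
    congr 1
    ext x
    rw [Finset.mem_filter]
    exact ⟨fun h => h.2, fun h => ⟨tri_subset_verts ht h, h⟩⟩
  rw [Finset.sum_congr rfl hT3] at h1
  have h2 := Finset.card_nsmul_le_sum (verts (gen T)) (fun v => (T.filter fun t => v ∈ t).card) 5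
    (fun v hv => hcon v hv)
  rw [h1, h7] at h2
  simp only [Finset.sum_const, smul_eq_mul] at h2
  omega

theorem model_of_labelling (T : Finset (Finset V)) (hT3 : ∀ t ∈ T, t.card = 3)
    (heven : ∀ s : Finset V, s.card = 2 → Even (T.filter fun t => s ⊆ t).card)
    (hne : T.Nonempty) (h10 : T.card ≤ 10) (e : V → ℕ) (he : Set.InjOn e ↑(verts (gen T)))
    (he7 : ∀ x ∈ verts (gen T), e x ∈ Finset.range 7)
    (hl : ((T.image (Finset.image e)).filter fun t => 6 ∈ t) = ∅ ∨
      ((T.image (Finset.image e)).filter fun t => 6 ∈ t) = {{1, 2, 6}, {2, 3, 6}, {1, 3, 6}} ∨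
      ((T.image (Finset.image e)).filter fun t => 6 ∈ t) =
        {{1, 2, 6}, {2, 3, 6}, {3, 4, 6}, {1, 4, 6}}) :
    ∃ m n, ∃ f : V → ℕ, (m, n) ∈ modelTab ∧ T.card = n ∧ Set.InjOn f ↑(verts (gen T)) ∧
      ∀ t ∈ T, t.image f ∈ modelF m := by
  have hc := image_card he
  have hA : ∀ t ∈ T.image (Finset.image e), t ⊆ Finset.range 7 ∧ t.card = 3 := by
    intro t' ht'
    obtain ⟨t, ht, rfl⟩ := Finset.mem_image.1 ht'
    constructor
    · intro x hx
      obtain ⟨y, hy, rfl⟩ := Finset.mem_image.1 hx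
      exact he7 y (tri_subset_verts ht hy)
    · rw [Finset.card_image_of_injOn, hT3 t ht]
      exact he.mono (fun x hx => tri_subset_verts ht hx)
  have hB : ∀ s : Finset ℕ, s.card = 2 →
      Even ((T.image (Finset.image e)).filter fun t => s ⊆ t).card := by
    intro s hs
    by_cases hex : ∃ t ∈ T, s ⊆ t.image e
    · obtain ⟨t, ht, hst⟩ := hex
      obtain ⟨r, hr, rfl⟩ := Finset.subset_image_iff.1 hst
      have hr' : r ⊆ t := by simpa using hr
      have hrS : r ⊆ verts (gen T) := hr'.trans (tri_subset_verts ht)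
      have hrc : r.card = 2 := by
        rw [← hs, Finset.card_image_of_injOn]
        exact he.mono (fun x hx => hrS hx)
      have hfil : ((T.image (Finset.image e)).filter fun t => r.image e ⊆ t) =
          (T.filter fun t => r ⊆ t).image (Finset.image e) := by
        rw [Finset.filter_image]
        congr 1
        apply Finset.filter_congr
        intro u hu
        exact image_sub_iff he hrS (tri_subset_verts hu)
      rw [hfil, Finset.card_image_of_injOn]
      · exact heven r hrc
      · intro u hu w hw huw
        have hu' := (Finset.mem_filter.1 (Finset.mem_coe.1 hu)).1
        have hw' := (Finset.mem_filter.1 (Finset.mem_coe.1 hw)).1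
        apply Finset.Subset.antisymm
        · exact (image_sub_iff he (tri_subset_verts hu') (tri_subset_verts hw')).1 huw.subset
        · exact (image_sub_iff he (tri_subset_verts hw') (tri_subset_verts hu')).1
            huw.symm.subset
    · rw [Finset.filter_eq_empty_iff.2]
      · simp
      · intro u hu
        obtain ⟨t, ht, rfl⟩ := Finset.mem_image.1 hu
        exact fun h => hex ⟨t, ht, h⟩
  obtain ⟨m, n, f, hmn, hcard, hf, hmem⟩ := core (T.image (Finset.image e)) hA hB
    (hne.image _) (by rw [hc]; exact h10) hl
  refine ⟨m, n, f ∘ e, hmn, by rw [← hc, hcard], ?_, ?_⟩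
  · exact hf.comp he (fun x hx => he7 x hx)
  · intro t ht
    rw [← Finset.image_image]
    exact hmem _ (Finset.mem_image_of_mem _ ht)

theorem filter_six (T : Finset (Finset V)) (e : V → ℕ) (he : Set.InjOn e ↑(verts (gen T)))
    (v : V) (hv : v ∈ verts (gen T)) (hv6 : e v = 6) :
    ((T.image (Finset.image e)).filter fun t => 6 ∈ t) =
      (T.filter fun t => v ∈ t).image (Finset.image e) := by
  rw [Finset.filter_image]
  congr 1
  apply Finset.filter_congr
  intro t ht
  rw [Finset.mem_image]
  constructor
  · rintro ⟨x, hx, hx6⟩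
    have := he (tri_subset_verts ht hx) hv (hx6.trans hv6.symm)
    exact this ▸ hx
  · exact fun h => ⟨v, h, hv6⟩

theorem exists_model (T : Finset (Finset V)) (hT3 : ∀ t ∈ T, t.card = 3)
    (heven : ∀ s : Finset V, s.card = 2 → Even (T.filter fun t => s ⊆ t).card)
    (hne : T.Nonempty) (h10 : T.card ≤ 10) (h7 : (verts (gen T)).card ≤ 7) :
    ∃ m n, ∃ f : V → ℕ, (m, n) ∈ modelTab ∧ T.card = n ∧ Set.InjOn f ↑(verts (gen T)) ∧
      ∀ t ∈ T, t.image f ∈ modelF m := by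
  have vm : ∀ {v x y}, LAdj T v x y → x ∈ verts (gen T) ∧ y ∈ verts (gen T) := by
    intro v x y h
    exact ⟨tri_subset_verts h.2.2.2 (by simp), tri_subset_verts h.2.2.2 (by simp)⟩
  rcases h7.lt_or_eq with hlt | h7
  · obtain ⟨e, he, hr, -⟩ := exists_labelling (verts (gen T))
      (Finset.range (verts (gen T)).card) (by simp) (fun _ => 0) ∅ (by simp) (by simp) (by simp)
    refine model_of_labelling T hT3 heven hne h10 e he ?_ (Or.inl ?_)
    · intro x hx
      have := Finset.mem_range.1 (hr x hx)
      rw [Finset.mem_range]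
      omega
    · rw [Finset.filter_eq_empty_iff]
      intro u hu h6
      obtain ⟨t, ht, rfl⟩ := Finset.mem_image.1 hu
      obtain ⟨x, hx, hx6⟩ := Finset.mem_image.1 h6
      have := Finset.mem_range.1 (hr x (tri_subset_verts ht hx))
      omega
  · obtain ⟨v, hv, h4⟩ := exists_low_degree T hT3 h10 h7
    have hvt := mem_verts_gen.1 hv
    rcases small_link T hT3 heven v hvt h4 with
      ⟨a, b, c, hab, hbc, hac, hL⟩ | ⟨a, b, c, d, hab, hbc, hcd, had, hac, hbd, hL⟩
    · have av := hab.1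
      have bv := hbc.1
      have cv := hbc.2.1
      have anb := hab.2.2.1
      have bnc := hbc.2.2.1
      have anc := hac.2.2.1
      obtain ⟨e, he, hr, hP⟩ := exists_labelling (verts (gen T)) (Finset.range 7) (by simp [h7])
        (fun x => if x = v then 6 else if x = a then 1 else if x = b then 2 else 3) {v, a, b, c}
        (by
          intro x hx
          simp only [Finset.mem_insert, Finset.mem_singleton] at hx
          rcases hx with rfl | rfl | rfl | rfl
          · exact hv
          · exact (vm hab).1
          · exact (vm hbc).1
          · exact (vm hbc).2)
        (by intro x _; rw [Finset.mem_range]; split_ifs <;> omega)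
        (by
          intro x hx y hy hxy
          simp only [Finset.coe_insert, Finset.coe_singleton, Set.mem_insert_iff,
            Set.mem_singleton_iff] at hx hy
          dsimp only at hxy
          grind)
      have ev : e v = 6 := by rw [hP v (by simp)]; simp
      have ea : e a = 1 := by rw [hP a (by simp)]; simp [av]
      have eb : e b = 2 := by rw [hP b (by simp)]; simp [bv, anb.symm]
      have ec : e c = 3 := by rw [hP c (by simp)]; simp [cv, anc.symm, bnc.symm]
      refine model_of_labelling T hT3 heven hne h10 e he hr (Or.inr (Or.inl ?_))
      rw [filter_six T e he v hv ev, hL]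
      simp only [Finset.image_insert, Finset.image_singleton, ev, ea, eb, ec]
      decide
    · have av := hab.1
      have bv := hbc.1
      have cv := hbc.2.1
      have dv := hcd.2.1
      have anb := hab.2.2.1
      have bnc := hbc.2.2.1
      have cnd := hcd.2.2.1
      have andd := had.2.2.1
      obtain ⟨e, he, hr, hP⟩ := exists_labelling (verts (gen T)) (Finset.range 7) (by simp [h7])
        (fun x => if x = v then 6 else if x = a then 1 else if x = b then 2 else
          if x = c then 3 else 4) {v, a, b, c, d}
        (by
          intro x hx
          simp only [Finset.mem_insert, Finset.mem_singleton] at hx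
          rcases hx with rfl | rfl | rfl | rfl | rfl
          · exact hv
          · exact (vm hab).1
          · exact (vm hbc).1
          · exact (vm hbc).2
          · exact (vm hcd).2)
        (by intro x _; rw [Finset.mem_range]; split_ifs <;> omega)
        (by
          intro x hx y hy hxy
          simp only [Finset.coe_insert, Finset.coe_singleton, Set.mem_insert_iff,
            Set.mem_singleton_iff] at hx hy
          dsimp only at hxy
          grind)
      have ev : e v = 6 := by rw [hP v (by simp)]; simp
      have ea : e a = 1 := by rw [hP a (by simp)]; simp [av]
      have eb : e b = 2 := by rw [hP b (by simp)]; simp [bv, anb.symm]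
      have ec : e c = 3 := by rw [hP c (by simp)]; simp [cv, hac.symm, bnc.symm]
      have ed : e d = 4 := by rw [hP d (by simp)]; simp [dv, andd.symm, hbd.symm, cnd.symm]
      refine model_of_labelling T hT3 heven hne h10 e he hr (Or.inr (Or.inr ?_))
      rw [filter_six T e he v hv ev, hL]
      simp only [Finset.image_insert, Finset.image_singleton, ev, ea, eb, ec, ed]
      decide

theorem eq_gen_of_pure (U : Finset (Finset V)) (hU : IsComplex U) (hpure : IsPure 2 U) :
    U = gen (U.filter fun s => s.card = 3) := by
  obtain ⟨-, hemp, hdown⟩ := hU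
  ext s
  rw [mem_gen]
  constructor
  · intro hs
    refine ⟨fun h => hemp (h ▸ hs), ?_⟩
    obtain ⟨t, hst, ht⟩ := U.exists_le_maximal hs
    refine ⟨t, Finset.mem_filter.2 ⟨ht.1, hpure t ?_⟩, hst⟩
    exact Finset.mem_filter.2 ⟨ht.1, fun u hu htu => Finset.Subset.antisymm (ht.2 hu htu) htu⟩
  · rintro ⟨hne, t, ht, hst⟩
    exact hdown t (Finset.mem_filter.1 ht).1 s hst (Finset.nonempty_iff_ne_empty.2 hne)

/-- Lemma 3.3: a 2-dimensional pure simplicial complex on at most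
7 vertices with at most 10 triangles, in which every edge lies in an even number
of triangles, is either a union of two combinatorial 2-spheres (on 4 or 5
vertices) with no common triangle, or is isomorphic to one of the listed
complexes. -/
theorem even_edge_degree_classification {V : Type*} [DecidableEq V]
    (U : Finset (Finset V)) (hU : IsComplex U) (hpure : IsPure 2 U)
    (h7 : (verts U).card ≤ 7)
    (htri : (U.filter fun s => s.card = 3).card ≤ 10)
    (heven : ∀ s ∈ U, s.card = 2 → Even (degOf U 2 s)) :
    (∃ K₁ K₂ : Finset (Finset V), IsComplex K₁ ∧ IsComplex K₂ ∧
      IsCombSphere 2 K₁ ∧ IsCombSphere 2 K₂ ∧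
      ((verts K₁).card = 4 ∨ (verts K₁).card = 5) ∧
      ((verts K₂).card = 4 ∨ (verts K₂).card = 5) ∧
      U = K₁ ∪ K₂ ∧ ∀ s ∈ K₁, s ∈ K₂ → s.card ≠ 3) ∨
    Iso U S24 ∨ Iso U S13S02 ∨ Iso U Octa ∨ Iso U S15S02 ∨ Iso U RP26 ∨
      Iso U Sigma1 ∨ Iso U Sigma2 ∨ Iso U Sigma3 ∨ Iso U Sigma4 ∨
      Iso U Sigma5 ∨ Iso U Rcomplex := by
  obtain ⟨T, hTdef⟩ : ∃ T, T = U.filter fun s => s.card = 3 := ⟨_, rfl⟩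
  have hgen : U = gen T := hTdef ▸ eq_gen_of_pure U hU hpure
  have hT3 : ∀ t ∈ T, t.card = 3 := by
    intro t ht
    rw [hTdef] at ht
    exact (Finset.mem_filter.1 ht).2
  have hne : T.Nonempty := by
    obtain ⟨s, hs⟩ := hU.1
    rw [hgen] at hs
    obtain ⟨-, t, ht, -⟩ := mem_gen.1 hs
    exact ⟨t, ht⟩
  have hev : ∀ s : Finset V, s.card = 2 → Even (T.filter fun t => s ⊆ t).card := by
    intro s hs
    by_cases hsU : s ∈ U
    · have h := heven s hsU hs
      have heq : degOf U 2 s = (T.filter fun t => s ⊆ t).card := by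
        rw [hTdef, Finset.filter_filter, degOf]
        congr 1
        apply Finset.filter_congr
        intro t _
        exact and_comm
      rwa [heq] at h
    · rw [Finset.filter_eq_empty_iff.2]
      · simp
      · intro t ht hst
        apply hsU
        rw [hgen]
        refine mem_gen.2 ⟨?_, t, ht, hst⟩
        rintro rfl
        simp at hs
  rw [← hTdef] at htri
  rw [hgen] at h7
  obtain ⟨m, n, f, hmn, hc, hf, hmem⟩ := exists_model T hT3 hev hne htri h7
  rw [hgen]
  exact final_of_model hT3 f hf hmn hc hmem

end HomologySpheres
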